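/- Let (G, P, L) be a minimum counterexample to the following statement, minimizing |V(G)| + |E(G)| and then the sum of the list sizes: 'Every plane graph G with no 4-cycle, with outer face F, subpath P ⊆ F with at most three vertices, and (*,1)-list assignment L satisfying conditions (i)–(vi) is L-colorable.' If v0v1v2 is a path on the outer cycle F with |L(v1)| = 3, then v0 and v2 are L2-vertices, and v0 and v2 are the only L2-vertices adjacent to v1. -/

import Mathlib

open Set

namespace ChoosSep

/-- `G` has a cycle of length `n`. -/
def HasCycleLen {V : Type} (G : SimpleGraph V) (n : ℕ) : Prop :=
  ∃ (v : V) (c : G.Walk v v), c.IsCycle ∧ c.length = n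

/-- `G` has a proper coloring choosing each color from the list `L v`. -/
def ColorableWith {V : Type} (G : SimpleGraph V) (L : V → Finset ℕ) : Prop :=
  ∃ φ : V → ℕ, (∀ v, φ v ∈ L v) ∧ ∀ ⦃u v⦄, G.Adj u v → φ u ≠ φ v

/-- `G` is `(k,d)`-choosable: it has an `L`-coloring for every list assignment
giving each vertex at least `k` colors and any two adjacent vertices at most `d`
common colors. -/
def Choosable {V : Type} (G : SimpleGraph V) (k d : ℕ) : Prop :=
  ∀ L : V → Finset ℕ, (∀ v, k ≤ (L v).card) →
    (∀ ⦃u v⦄, G.Adj u v → ((L u) ∩ (L v)).card ≤ d) →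
    ColorableWith G L

/-- The closed straight segment between two points of the plane. -/
def seg (x y : ℝ × ℝ) : Set (ℝ × ℝ) := segment ℝ x y

/-- A straight-line plane embedding of `G`: vertices go to distinct points, edges are
drawn as straight segments, two distinct edges meet only in common endpoints, and no
vertex lies on the drawing of an edge it does not belong to.  By Fáry's theorem a
finite simple graph admits such an embedding iff it is planar. -/
structure PlaneEmb {V : Type} (G : SimpleGraph V) where
  pos : V → ℝ × ℝ
  inj : Function.Injective pos
  edges_meet : ∀ ⦃a b c d : V⦄, G.Adj a b → G.Adj c d → s(a, b) ≠ s(c, d) →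
    seg (pos a) (pos b) ∩ seg (pos c) (pos d) ⊆ ({pos a, pos b} ∩ {pos c, pos d} : Set (ℝ × ℝ))
  vertex_off : ∀ ⦃a b v : V⦄, G.Adj a b → v ≠ a → v ≠ b → pos v ∉ seg (pos a) (pos b)

/-- `G` is planar: it admits a plane embedding. -/
def IsPlanar {V : Type} (G : SimpleGraph V) : Prop := Nonempty (PlaneEmb G)

variable {V : Type} {G : SimpleGraph V}

/-- The drawing of the graph in the plane: all vertex points and all edge segments. -/
def PlaneEmb.drawing (E : PlaneEmb G) : Set (ℝ × ℝ) :=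
  Set.range E.pos ∪ ⋃ (a : V) (b : V) (_ : G.Adj a b), seg (E.pos a) (E.pos b)

/-- A face of the embedding: a connected component of the complement of the drawing. -/
def PlaneEmb.IsFace (E : PlaneEmb G) (C : Set (ℝ × ℝ)) : Prop :=
  ∃ q, q ∉ E.drawing ∧ C = connectedComponentIn E.drawingᶜ q

/-- The outer face: the unbounded face. -/
def PlaneEmb.IsOuterFace (E : PlaneEmb G) (C : Set (ℝ × ℝ)) : Prop :=
  E.IsFace C ∧ ¬ Bornology.IsBounded C

/-- The vertices lying on the boundary of the face `C`. -/
def PlaneEmb.onFace (E : PlaneEmb G) (C : Set (ℝ × ℝ)) : Set V :=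
  {v | E.pos v ∈ closure C}

/-- An edge of `G` lying on the boundary of the face `C`. -/
def PlaneEmb.BoundaryEdge (E : PlaneEmb G) (C : Set (ℝ × ℝ)) (u v : V) : Prop :=
  G.Adj u v ∧ seg (E.pos u) (E.pos v) ⊆ closure C

/-- `C` is a 3-face with (mutually adjacent) incident vertices `x`, `y`, `z`. -/
def PlaneEmb.IsTriFace (E : PlaneEmb G) (C : Set (ℝ × ℝ)) (x y z : V) : Prop :=
  E.IsFace C ∧ G.Adj x y ∧ G.Adj y z ∧ G.Adj x z ∧
    frontier C = seg (E.pos x) (E.pos y) ∪ seg (E.pos y) (E.pos z) ∪ seg (E.pos x) (E.pos z)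

/-- `C` is a 4-face with incident 4-cycle `w x y z`. -/
def PlaneEmb.IsQuadFace (E : PlaneEmb G) (C : Set (ℝ × ℝ)) (w x y z : V) : Prop :=
  E.IsFace C ∧ G.Adj w x ∧ G.Adj x y ∧ G.Adj y z ∧ G.Adj z w ∧ w ≠ y ∧ x ≠ z ∧
    frontier C = seg (E.pos w) (E.pos x) ∪ seg (E.pos x) (E.pos y) ∪
      seg (E.pos y) (E.pos z) ∪ seg (E.pos z) (E.pos w)

/-- `x z1 y z2` is a diamond: a 4-cycle formed by two adjacent 3-faces
`x y z1` and `x y z2` sharing the edge `x y`. -/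
def PlaneEmb.IsDiamond (E : PlaneEmb G) (x z1 y z2 : V) : Prop :=
  z1 ≠ z2 ∧ ∃ C1 C2 : Set (ℝ × ℝ), C1 ≠ C2 ∧ E.IsTriFace C1 x y z1 ∧ E.IsTriFace C2 x y z2

/-- The union of the three sides of the triangle `a b c`. -/
def triBoundary (a b c : ℝ × ℝ) : Set (ℝ × ℝ) := seg a b ∪ seg b c ∪ seg a c

/-- The open interior region of the triangle `a b c`: points off the triangle whose
connected component in the complement of the triangle is bounded. -/
def triInterior (a b c : ℝ × ℝ) : Set (ℝ × ℝ) :=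
  {p | p ∉ triBoundary a b c ∧
    Bornology.IsBounded (connectedComponentIn (triBoundary a b c)ᶜ p)}

/-- The degree of a vertex. -/
noncomputable def deg (G : SimpleGraph V) (v : V) : ℕ := Nat.card {u : V // G.Adj v u}

/-- `G` is 2-connected: connected and with no cutvertex. -/
def TwoConnected (G : SimpleGraph V) : Prop :=
  G.Connected ∧ ∀ v : V, (G.induce {u : V | u ≠ v}).Connected

/-- A configuration for Theorem 6: a plane graph with no 4-cycle, outer face `F`, a
precolored subpath `P` of the outer face with at most three vertices, and a
`(*,1)`-list assignment `L` satisfying conditions (i)–(vi). -/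
structure Cfg4 where
  n : ℕ
  G : SimpleGraph (Fin n)
  E : PlaneEmb G
  F : Set (ℝ × ℝ)
  P : List (Fin n)
  L : Fin n → Finset ℕ

namespace Cfg4

/-- All hypotheses of Theorem 6 hold for the configuration. -/
def Valid (C : Cfg4) : Prop :=
  (¬ HasCycleLen C.G 4) ∧
  C.E.IsOuterFace C.F ∧
  C.P.Nodup ∧ C.P.length ≤ 3 ∧
  (∀ v ∈ C.P, v ∈ C.E.onFace C.F) ∧
  C.P.Chain' (C.E.BoundaryEdge C.F) ∧
  (∀ v, 1 ≤ (C.L v).card) ∧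
  (∀ ⦃u v⦄, C.G.Adj u v → ((C.L u) ∩ (C.L v)).card ≤ 1) ∧
  (∀ v, v ∉ C.E.onFace C.F → 3 ≤ (C.L v).card) ∧
  (∀ v ∈ C.E.onFace C.F, v ∉ C.P → 2 ≤ (C.L v).card) ∧
  (∀ v ∈ C.P, (C.L v).card = 1) ∧
  (∀ ⦃u v⦄, C.G.Adj u v → (C.L u).card = 2 → (C.L v).card ≠ 2) ∧
  (∃ φ : Fin C.n → ℕ, (∀ v ∈ C.P, φ v ∈ C.L v) ∧
    ∀ ⦃u v⦄, u ∈ C.P → v ∈ C.P → C.G.Adj u v → φ u ≠ φ v) ∧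
  (∀ x, (C.L x).card = 2 → ∀ u ∈ C.P, ∀ v ∈ C.P, u ≠ v →
    C.G.Adj x u → C.G.Adj x v → False)

/-- The configuration admits an `L`-coloring. -/
def Colorable (C : Cfg4) : Prop := ColorableWith C.G C.L

/-- The quantity `|V(G)| + |E(G)|`. -/
noncomputable def measure (C : Cfg4) : ℕ := C.n + Nat.card ↥C.G.edgeSet

/-- The sum of the sizes of the lists. -/
def listSum (C : Cfg4) : ℕ := ∑ v, (C.L v).card

/-- `C` is a minimum counterexample to Theorem 6: it satisfies the hypotheses, has no
`L`-coloring, and minimizes `|V(G)| + |E(G)|` and then the sum of the list sizes among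
all such counterexamples. -/
def MinCounterexample (C : Cfg4) : Prop :=
  C.Valid ∧ ¬ C.Colorable ∧
    ∀ D : Cfg4, D.Valid → ¬ D.Colorable →
      C.measure ≤ D.measure ∧ (D.measure = C.measure → C.listSum ≤ D.listSum)

/-- `uv` is a chord of the outer cycle: an edge between two vertices of the outer
face that is not an edge of the outer face. -/
def IsChord (C : Cfg4) (u v : Fin C.n) : Prop :=
  C.G.Adj u v ∧ u ∈ C.E.onFace C.F ∧ v ∈ C.E.onFace C.F ∧ ¬ C.E.BoundaryEdge C.F u v

/-- A chord `uv` is bad if one of its `Q`-components is a triangle `u v x` with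
`|L(x)| = 2`: i.e. there is an `L2`-vertex `x` with `ux` and `xv` edges of the outer
cycle such that the triangle `u x v` encloses no vertex of `G`. -/
def IsBadChord (C : Cfg4) (u v : Fin C.n) : Prop :=
  C.IsChord u v ∧ ∃ x : Fin C.n, (C.L x).card = 2 ∧
    C.G.Adj u x ∧ C.G.Adj x v ∧
    C.E.BoundaryEdge C.F u x ∧ C.E.BoundaryEdge C.F x v ∧
    ∀ w : Fin C.n, C.E.pos w ∉ triInterior (C.E.pos u) (C.E.pos x) (C.E.pos v)

/-- `v0 v1 v2` is a 2-chord of the outer cycle. -/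
def Is2Chord (C : Cfg4) (v0 v1 v2 : Fin C.n) : Prop :=
  C.G.Adj v0 v1 ∧ C.G.Adj v1 v2 ∧ v0 ≠ v2 ∧
    v0 ∈ C.E.onFace C.F ∧ v2 ∈ C.E.onFace C.F ∧ v1 ∉ C.E.onFace C.F

/-- A 2-chord `v0 v1 v2` is separating if `v0 v2` is not an edge of the outer cycle. -/
def IsSep2Chord (C : Cfg4) (v0 v1 v2 : Fin C.n) : Prop :=
  C.Is2Chord v0 v1 v2 ∧ ¬ C.E.BoundaryEdge C.F v0 v2

/-- `v` is a middle vertex: it has degree two in the path `P`. -/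
def IsMiddle (C : Cfg4) (v : Fin C.n) : Prop :=
  ∃ a b, C.P = [a, v, b]

/-- `v0 v1 v2` is a path on the outer cycle `F`. -/
def IsOuterPath (C : Cfg4) (v0 v1 v2 : Fin C.n) : Prop :=
  v0 ≠ v2 ∧ C.E.BoundaryEdge C.F v0 v1 ∧ C.E.BoundaryEdge C.F v1 v2

end Cfg4

open Topology

/-- The identification of the coordinate plane with the complex numbers. -/
noncomputable def toC : (ℝ × ℝ) ≃L[ℝ] ℂ := Complex.equivRealProdCLM.symm

lemma div_mem_slitPlane_of_notMem_segment {a b p : ℂ} (h : p ∉ segment ℝ a b) :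
    (b - p) / (a - p) ∈ Complex.slitPlane := by
  have ha : a - p ≠ 0 := fun h0 => h (by rw [← sub_eq_zero.1 h0]; exact left_mem_segment ℝ a b)
  by_contra hs
  rw [Complex.mem_slitPlane_iff, not_or, not_lt, not_not] at hs
  obtain ⟨hre, him⟩ := hs
  obtain ⟨t, ht⟩ : ∃ t : ℝ, t = -((b - p) / (a - p)).re := ⟨_, rfl⟩
  have ht0 : 0 ≤ t := by linarith
  have hz : (b - p) / (a - p) = -(t : ℂ) := by
    apply Complex.ext <;> simp [ht, him]
  rw [div_eq_iff ha] at hz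
  apply h
  refine ⟨t / (1 + t), 1 / (1 + t), by positivity, by positivity, by field_simp; ring, ?_⟩
  have h1 : (1 + t : ℂ) ≠ 0 := by
    have : (1 + t : ℝ) ≠ 0 := by positivity
    exact_mod_cast this
  simp only [Complex.real_smul]
  push_cast
  field_simp
  linear_combination hz

/-- The oriented angle under which the segment `ab` is seen from `p`. -/
noncomputable def viewAngle (a b p : ℝ × ℝ) : ℝ :=
  ((toC b - toC p) / (toC a - toC p)).arg

lemma toC_mem_segment {a b p : ℝ × ℝ} : toC p ∈ segment ℝ (toC a) (toC b) ↔ p ∈ seg a b := by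
  constructor
  · rintro ⟨x, y, hx, hy, hxy, h⟩
    refine ⟨x, y, hx, hy, hxy, toC.injective ?_⟩
    simpa using h
  · rintro ⟨x, y, hx, hy, hxy, h⟩
    refine ⟨x, y, hx, hy, hxy, ?_⟩
    rw [← h]; simp

lemma viewAngle_mem_slitPlane {a b p : ℝ × ℝ} (h : p ∉ seg a b) :
    (toC b - toC p) / (toC a - toC p) ∈ Complex.slitPlane :=
  div_mem_slitPlane_of_notMem_segment (by rwa [toC_mem_segment])

lemma left_mem_seg (a b : ℝ × ℝ) : a ∈ seg a b := left_mem_segment ℝ a b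

lemma right_mem_seg (a b : ℝ × ℝ) : b ∈ seg a b := right_mem_segment ℝ a b

lemma continuousAt_viewAngle {a b p : ℝ × ℝ} (h : p ∉ seg a b) :
    ContinuousAt (viewAngle a b) p := by
  have ha : toC a - toC p ≠ 0 := fun h0 => h (by
    rw [← toC.injective (sub_eq_zero.1 h0)]; exact left_mem_seg a b)
  refine ContinuousAt.comp (g := Complex.arg)
    (f := fun p => (toC b - toC p) / (toC a - toC p))
    (Complex.continuousAt_arg (viewAngle_mem_slitPlane h)) ?_
  have hc : ContinuousAt toC p := toC.continuous.continuousAt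
  exact (continuousAt_const.sub hc).div (continuousAt_const.sub hc) ha

lemma toC_sub_ne_zero {a p : ℝ × ℝ} (h : a ≠ p) : toC a - toC p ≠ 0 :=
  sub_ne_zero.2 fun h0 => h (toC.injective h0)

lemma coe_viewAngle {a b p : ℝ × ℝ} (ha : a ≠ p) (hb : b ≠ p) :
    (viewAngle a b p : Real.Angle) = (toC b - toC p).arg - (toC a - toC p).arg :=
  Complex.arg_div_coe_angle (toC_sub_ne_zero hb) (toC_sub_ne_zero ha)

lemma abs_viewAngle_le (a b p : ℝ × ℝ) : |viewAngle a b p| ≤ Real.pi := Complex.abs_arg_le_pi _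

/-- The total angle under which a drawn walk is seen from `p`. -/
noncomputable def PlaneEmb.walkAngle (E : PlaneEmb G) : ∀ {a b : V}, G.Walk a b → ℝ × ℝ → ℝ
  | _, _, .nil, _ => 0
  | _, _, .cons (u := a) (v := b) _ w, p => viewAngle (E.pos a) (E.pos b) p + E.walkAngle w p

/-- The point `p` avoids the drawing of the subgraph induced by `S`. -/
def PlaneEmb.Off (E : PlaneEmb G) (S : Set V) (p : ℝ × ℝ) : Prop :=
  (∀ c ∈ S, E.pos c ≠ p) ∧ ∀ a ∈ S, ∀ b ∈ S, G.Adj a b → p ∉ seg (E.pos a) (E.pos b)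

lemma PlaneEmb.Off.mono {E : PlaneEmb G} {S T : Set V} {p : ℝ × ℝ} (h : E.Off T p)
    (hST : S ⊆ T) : E.Off S p :=
  ⟨fun c hc => h.1 c (hST hc), fun a ha b hb => h.2 a (hST ha) b (hST hb)⟩

lemma PlaneEmb.coe_walkAngle (E : PlaneEmb G) {S : Set V} {p : ℝ × ℝ} (hp : E.Off S p) {a b : V}
    (w : G.Walk a b) (hw : ∀ c ∈ w.support, c ∈ S) :
    (E.walkAngle w p : Real.Angle) =
      (toC (E.pos b) - toC p).arg - (toC (E.pos a) - toC p).arg := by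
  induction w with
  | nil => simp [walkAngle]
  | cons h w ih =>
    rw [walkAngle, Real.Angle.coe_add, ih fun c hc => hw c (by simp [hc]),
      coe_viewAngle (hp.1 _ (hw _ (by simp))) (hp.1 _ (hw _ (by simp)))]
    abel

lemma PlaneEmb.continuousAt_walkAngle (E : PlaneEmb G) {S : Set V} {p : ℝ × ℝ} (hp : E.Off S p)
    {a b : V} (w : G.Walk a b) (hw : ∀ c ∈ w.support, c ∈ S) :
    ContinuousAt (E.walkAngle w) p := by
  induction w with
  | nil => exact continuousAt_const
  | cons h w ih =>
    exact (continuousAt_viewAngle (hp.2 _ (hw _ (by simp)) _ (hw _ (by simp)) h)).add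
      (ih fun c hc => hw c (by simp [hc]))

lemma eq_of_coe_angle_eq {X : Type*} [TopologicalSpace X] {S : Set X} (hS : IsPreconnected S)
    {f : X → ℝ} (hf : ContinuousOn f S) {θ : Real.Angle} (hθ : ∀ p ∈ S, (f p : Real.Angle) = θ)
    {p q : X} (hp : p ∈ S) (hq : q ∈ S) : f p = f q := by
  have key : ∀ p ∈ S, ∀ q ∈ S, ¬ f p < f q := by
    intro p hp q hq hlt
    obtain ⟨k, hk⟩ := Real.Angle.angle_eq_iff_two_pi_dvd_sub.1 ((hθ q hq).trans (hθ p hp).symm)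
    have hk0 : (0 : ℝ) < k := by
      have := Real.pi_pos
      by_contra hneg
      nlinarith
    have hk1 : (1 : ℝ) ≤ k := by exact_mod_cast hk0
    have hpi := Real.pi_pos
    obtain ⟨r, hr, hrp⟩ := hS.intermediate_value hp hq hf
      (show f p + Real.pi ∈ Set.Icc (f p) (f q) from ⟨by linarith, by nlinarith⟩)
    obtain ⟨m, hm⟩ := Real.Angle.angle_eq_iff_two_pi_dvd_sub.1 ((hθ r hr).trans (hθ p hp).symm)
    rw [hrp] at hm
    have h2 : (1 : ℝ) = 2 * m := by
      have : Real.pi * (1 - 2 * m) = 0 := by linarith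
      rcases mul_eq_zero.1 this with h | h
      · exact absurd h hpi.ne'
      · linarith
    have h3 : (1 : ℤ) = 2 * m := by exact_mod_cast h2
    omega
  exact le_antisymm (not_lt.1 (key q hq p hp)) (not_lt.1 (key p hp q hq))

lemma eventually_eq_add_pi {X : Type*} [TopologicalSpace X] {k : X → ℝ} {q : X}
    (hk : ContinuousAt k q) (hq : (k q : Real.Angle) = Real.pi) {B : ℝ} (hB : B < 3 * Real.pi) :
    ∀ᶠ p in 𝓝 q, ∀ s : ℝ, |s| ≤ B → ((s + k p : ℝ) : Real.Angle) = 0 →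
      s + k p = k q + (if 0 ≤ s then Real.pi else -Real.pi) := by
  have hpos : 0 < min 1 (3 * Real.pi - B) := lt_min one_pos (by linarith)
  filter_upwards [Metric.continuousAt_iff'.1 hk _ hpos] with p hp s hs h0
  rw [Real.dist_eq, lt_min_iff] at hp
  obtain ⟨m, hm⟩ := Real.Angle.angle_eq_iff_two_pi_dvd_sub.1
    (show ((s + k p : ℝ) : Real.Angle) = ((k q + Real.pi : ℝ) : Real.Angle) by
      rw [h0, Real.Angle.coe_add, hq, Real.Angle.coe_pi_add_coe_pi])
  have hpi := Real.pi_gt_three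
  have h1 := abs_lt.1 hp.1
  have h2 := abs_lt.1 hp.2
  have hs' := abs_le.1 hs
  have hm1 : m < 1 := by
    by_contra hc
    have : (1 : ℝ) ≤ m := by exact_mod_cast not_lt.1 hc
    nlinarith
  have hm2 : -2 < m := by
    by_contra hc
    have : (m : ℝ) ≤ -2 := by exact_mod_cast not_lt.1 hc
    nlinarith
  have hm3 : m = 0 ∨ m = -1 := by omega
  split_ifs with h
  · rcases hm3 with rfl | rfl
    · push_cast at hm; linarith
    · push_cast at hm; linarith
  · rcases hm3 with rfl | rfl
    · push_cast at hm; linarith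
    · push_cast at hm; linarith

lemma viewAngle_of_left {a b c : ℝ × ℝ} {s : ℝ} (hs : 0 < s) :
    viewAngle a b (a + s • (c - a)) =
      (-((toC (b - a) - s * toC (c - a)) / toC (c - a))).arg := by
  have hpos : (0 : ℝ) < s⁻¹ := by positivity
  rw [viewAngle, ← Complex.arg_real_mul (-((toC (b - a) - s * toC (c - a)) / toC (c - a))) hpos]
  congr 1
  have hs' : (s : ℂ) ≠ 0 := by exact_mod_cast hs.ne'
  simp only [map_add, map_smul, map_sub, Complex.real_smul]
  by_cases hc : toC c - toC a = 0
  · simp [hc]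
  · have : toC a - (toC a + s * (toC c - toC a)) = -(s * (toC c - toC a)) := by ring
    rw [this, Complex.ofReal_inv]
    field_simp
    ring

lemma viewAngle_of_right {a u r : ℝ × ℝ} {s : ℝ} (hs : s < 1) :
    viewAngle u r (a + s • (u - a)) =
      ((toC (r - u) + (1 - s) * toC (u - a)) / toC (u - a)).arg := by
  have hpos : (0 : ℝ) < (1 - s)⁻¹ := inv_pos.2 (by linarith)
  rw [viewAngle, ← Complex.arg_real_mul ((toC (r - u) + (1 - s) * toC (u - a)) / toC (u - a)) hpos]
  congr 1
  have hs' : (1 - s : ℂ) ≠ 0 := by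
    have : (1 - s : ℝ) ≠ 0 := by linarith
    exact_mod_cast this
  simp only [map_add, map_smul, map_sub, Complex.real_smul]
  by_cases hc : toC u - toC a = 0
  · simp [sub_eq_zero.1 hc]
  · have : toC u - (toC a + s * (toC u - toC a)) = (1 - s) * (toC u - toC a) := by ring
    rw [this]
    push_cast
    field_simp
    ring

lemma neg_div_mem_slitPlane {a b c : ℝ × ℝ} (hb : b ∉ seg a c) (hc : c ∉ seg a b) :
    -(toC (b - a) / toC (c - a)) ∈ Complex.slitPlane := by
  have hca : toC (c - a) ≠ 0 := by
    rw [map_sub]; exact toC_sub_ne_zero fun h => hc (h ▸ left_mem_seg c b)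
  have hba : toC (b - a) ≠ 0 := by
    rw [map_sub]; exact toC_sub_ne_zero fun h => hb (h ▸ left_mem_seg b c)
  by_contra hs
  rw [Complex.mem_slitPlane_iff, not_or, not_lt, not_not] at hs
  obtain ⟨hre, him⟩ := hs
  obtain ⟨t, ht⟩ : ∃ t : ℝ, t = (toC (b - a) / toC (c - a)).re := ⟨_, rfl⟩
  have ht0 : 0 ≤ t := by rw [Complex.neg_re] at hre; linarith
  have hz : toC (b - a) / toC (c - a) = t := by
    apply Complex.ext
    · simp [ht]
    · simpa using him
  have ht1 : 0 < t := lt_of_le_of_ne ht0 fun h => by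
    rw [← h, Complex.ofReal_zero] at hz
    exact div_ne_zero hba hca hz
  rw [div_eq_iff hca] at hz
  have hz' : b - a = t • (c - a) := toC.injective (by simpa using hz)
  rcases le_or_gt t 1 with h1 | h1
  · apply hb
    rw [seg, segment_eq_image']
    exact ⟨t, ⟨ht0, h1⟩, by simp [← hz']⟩
  · apply hc
    rw [seg, segment_eq_image']
    refine ⟨t⁻¹, ⟨by positivity, inv_le_one_of_one_le₀ h1.le⟩, ?_⟩
    simp [hz', smul_smul, inv_mul_cancel₀ ht1.ne']

namespace PlaneEmb

lemma off_vertex (E : PlaneEmb G) {S : Set V} {v : V} (hv : v ∉ S) : E.Off S (E.pos v) :=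
  ⟨fun _ hc h => hv (E.inj h ▸ hc), fun _ ha _ hb hab =>
    E.vertex_off hab (fun h => hv (h ▸ ha)) fun h => hv (h ▸ hb)⟩

lemma off_edge (E : PlaneEmb G) {S : Set V} {v y : V} (hv : v ∉ S) (h : G.Adj v y) {p : ℝ × ℝ}
    (hp : p ∈ seg (E.pos v) (E.pos y)) (hpy : p ≠ E.pos y) : E.Off S p := by
  refine ⟨fun c hc hcp => ?_, fun a ha b hb hab hpab => ?_⟩
  · refine E.vertex_off h (v := c) (fun e => hv (e ▸ hc)) ?_ (hcp ▸ hp)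
    rintro rfl
    exact hpy hcp.symm
  · have hne : s(v, y) ≠ s(a, b) := by
      intro e
      have : v ∈ s(a, b) := e ▸ Sym2.mem_mk_left v y
      rcases Sym2.mem_iff.1 this with rfl | rfl
      exacts [hv ha, hv hb]
    obtain ⟨h1, h2⟩ := E.edges_meet h hab hne ⟨hp, hpab⟩
    rcases h1 with rfl | h1
    · rcases h2 with h2 | h2
      · exact hv (E.inj h2 ▸ ha)
      · exact hv (E.inj h2 ▸ hb)
    · exact hpy h1

lemma notMem_seg_of_mem_seg (E : PlaneEmb G) {v y j : V} (hy : G.Adj v y) (hj : G.Adj v j)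
    (hne : y ≠ j) {p : ℝ × ℝ} (hp : p ∈ seg (E.pos v) (E.pos y)) (hpv : p ≠ E.pos v) :
    p ∉ seg (E.pos v) (E.pos j) := by
  intro hpj
  have hs : s(v, y) ≠ s(v, j) := by
    intro e
    rcases Sym2.eq_iff.1 e with ⟨-, h⟩ | ⟨h, -⟩
    · exact hne h
    · exact hj.ne h
  obtain ⟨h1, h2⟩ := E.edges_meet hy hj hs ⟨hp, hpj⟩
  rcases h1 with h1 | h1
  · exact hpv h1
  rcases h2 with h2 | h2
  · exact hpv h2
  · exact hne (E.inj (h1.symm.trans h2))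

lemma add_smul_mem_seg {a b : ℝ × ℝ} {s : ℝ} (h0 : 0 ≤ s) (h1 : s ≤ 1) :
    a + s • (b - a) ∈ seg a b := by
  rw [seg, segment_eq_image']
  exact ⟨s, ⟨h0, h1⟩, rfl⟩

lemma add_smul_ne_left {a b : ℝ × ℝ} (hab : a ≠ b) {s : ℝ} (h0 : s ≠ 0) :
    a + s • (b - a) ≠ a := by
  simp [h0, sub_eq_zero, hab.symm]

lemma add_smul_ne_right {a b : ℝ × ℝ} (hab : a ≠ b) {s : ℝ} (h1 : s ≠ 1) :
    a + s • (b - a) ≠ b := by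
  intro h
  have h2 : (s - 1) • (b - a) = 0 := by
    rw [sub_smul, one_smul, sub_eq_zero, ← sub_eq_iff_eq_add'.2 h.symm]
  rcases smul_eq_zero.1 h2 with h3 | h3
  · exact h1 (by linarith)
  · exact hab (sub_eq_zero.1 h3).symm

/-- Along an edge `vy`, the angle of view of another edge at `v`, corrected by a function with
the appropriate residue, keeps the limit value it has at `v`. -/
lemma sub_viewAngle_eq (E : PlaneEmb G) {v y j : V} (hy : G.Adj v y) (hj : G.Adj v j)
    (hne : y ≠ j) {Q : ℝ → ℝ} {c : ℝ} (hc0 : 0 < c) (hc1 : c ≤ 1)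
    (hQ : ContinuousOn Q (Icc 0 c))
    (hQa : ∀ s ∈ Icc 0 c, (Q s : Real.Angle) =
      (toC (E.pos j) - toC (E.pos v + s • (E.pos y - E.pos v))).arg -
        (toC (E.pos y - E.pos v)).arg) :
    Q c - viewAngle (E.pos v) (E.pos j) (E.pos v + c • (E.pos y - E.pos v)) =
        Q 0 - (-(toC (E.pos j - E.pos v) / toC (E.pos y - E.pos v))).arg ∧
      ((Q c - viewAngle (E.pos v) (E.pos j) (E.pos v + c • (E.pos y - E.pos v)) : ℝ) :
        Real.Angle) = Real.pi := by
  have hposy : E.pos v ≠ E.pos y := fun h => hy.ne (E.inj h)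
  have hd : toC (E.pos y - E.pos v) ≠ 0 := by
    rw [map_sub]; exact toC_sub_ne_zero hposy.symm
  let h : ℝ → ℝ := fun s => Q s -
    (-((toC (E.pos j - E.pos v) - s * toC (E.pos y - E.pos v)) / toC (E.pos y - E.pos v))).arg
  have hw : ∀ s : ℝ, toC (E.pos j - E.pos v) - s * toC (E.pos y - E.pos v) =
      toC (E.pos j) - toC (E.pos v + s • (E.pos y - E.pos v)) := by
    intro s
    simp only [map_add, map_sub, map_smul, Complex.real_smul]
    ring
  have hslit : ∀ s ∈ Icc 0 c, -((toC (E.pos j - E.pos v) - s * toC (E.pos y - E.pos v)) /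
      toC (E.pos y - E.pos v)) ∈ Complex.slitPlane := by
    intro s hs
    rcases eq_or_lt_of_le hs.1 with h0 | h0
    · rw [← h0]
      simpa using neg_div_mem_slitPlane (E.vertex_off hy hj.ne' hne.symm)
        (E.vertex_off hj hy.ne' hne)
    · have hmem : E.pos v + s • (E.pos y - E.pos v) ∉ seg (E.pos v) (E.pos j) :=
        E.notMem_seg_of_mem_seg hy hj hne (add_smul_mem_seg hs.1 (hs.2.trans hc1))
          (add_smul_ne_left hposy h0.ne')
      rw [Complex.mem_slitPlane_iff_arg, ← viewAngle_of_left h0]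
      refine ⟨(Complex.mem_slitPlane_iff_arg.1 (viewAngle_mem_slitPlane hmem)).1, ?_⟩
      rw [neg_ne_zero, hw]
      refine div_ne_zero (toC_sub_ne_zero fun e => hmem ?_) hd
      rw [← e]; exact right_mem_seg _ _
  have hcont : ContinuousOn h (Icc 0 c) := by
    refine hQ.sub fun s hs => ?_
    refine ContinuousAt.continuousWithinAt ?_
    refine ContinuousAt.comp (g := Complex.arg) (Complex.continuousAt_arg (hslit s hs)) ?_
    fun_prop
  have hang : ∀ s ∈ Icc 0 c, (h s : Real.Angle) = Real.pi := by
    intro s hs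
    have hw0 : toC (E.pos j) - toC (E.pos v + s • (E.pos y - E.pos v)) ≠ 0 := by
      have := Complex.slitPlane_ne_zero (hslit s hs)
      rw [neg_ne_zero, hw] at this
      exact fun e => this (by rw [e, zero_div])
    simp only [h]
    rw [hw, Real.Angle.coe_sub, hQa s hs, Complex.arg_neg_coe_angle (div_ne_zero hw0 hd),
      Complex.arg_div_coe_angle hw0 hd, sub_add_eq_sub_sub, sub_self, zero_sub,
      Real.Angle.neg_coe_pi]
  have hcc : c ∈ Icc 0 c := ⟨hc0.le, le_rfl⟩
  have key := eq_of_coe_angle_eq isPreconnected_Icc hcont hang hcc ⟨le_rfl, hc0.le⟩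
  have hhc : h c =
      Q c - viewAngle (E.pos v) (E.pos j) (E.pos v + c • (E.pos y - E.pos v)) := by
    simp only [h]; rw [viewAngle_of_left hc0]
  have hh0 : h 0 = Q 0 - (-(toC (E.pos j - E.pos v) / toC (E.pos y - E.pos v))).arg := by
    simp [h]
  rw [← hhc, ← hh0]
  exact ⟨key, hang c hcc⟩

/-- The midpoint of an edge. -/
noncomputable def mid (E : PlaneEmb G) (v y : V) : ℝ × ℝ :=
  E.pos v + (1 / 2 : ℝ) • (E.pos y - E.pos v)

lemma eventually_edge (E : PlaneEmb G) {v yi yj r : V} (hi : G.Adj v yi) (hj : G.Adj v yj)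
    (hne : yi ≠ yj) (Wi : G.Walk yi r) (Wj : G.Walk yj r) (hWi : v ∉ Wi.support)
    (hWj : v ∉ Wj.support) :
    ∀ᶠ p in 𝓝 (E.mid v yi), E.Off univ p →
      E.walkAngle (.cons hi Wi) p - E.walkAngle (.cons hj Wj) p =
        E.walkAngle Wi (E.pos v) - E.walkAngle Wj (E.pos v) -
          (-(toC (E.pos yj - E.pos v) / toC (E.pos yi - E.pos v))).arg +
          (if 0 ≤ viewAngle (E.pos v) (E.pos yi) p then Real.pi else -Real.pi) := by
  have hposy : E.pos v ≠ E.pos yi := fun h => hi.ne (E.inj h)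
  have hSi : ∀ c ∈ Wi.support, c ∈ ({v}ᶜ : Set V) := fun c hc e => hWi (e ▸ hc)
  have hSj : ∀ c ∈ Wj.support, c ∈ ({v}ᶜ : Set V) := fun c hc e => hWj (e ▸ hc)
  have hoff : ∀ s ∈ Icc (0 : ℝ) (1 / 2),
      E.Off {v}ᶜ (E.pos v + s • (E.pos yi - E.pos v)) := by
    intro s hs
    refine E.off_edge (by simp) hi (add_smul_mem_seg hs.1 (by linarith [hs.2]))
      (add_smul_ne_right hposy (by linarith [hs.2]))
  have hline : ∀ s : ℝ, ContinuousAt (fun s : ℝ => E.pos v + s • (E.pos yi - E.pos v)) s :=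
    fun s => by fun_prop
  obtain ⟨h1, h2⟩ := E.sub_viewAngle_eq hi hj hne
    (Q := fun s => E.walkAngle Wi (E.pos v + s • (E.pos yi - E.pos v)) -
      E.walkAngle Wj (E.pos v + s • (E.pos yi - E.pos v))) (c := 1 / 2) (by norm_num)
    (by norm_num)
    (fun s hs => (((E.continuousAt_walkAngle (hoff s hs) Wi hSi).comp
      (f := fun s : ℝ => E.pos v + s • (E.pos yi - E.pos v)) (hline s)).sub
      ((E.continuousAt_walkAngle (hoff s hs) Wj hSj).comp
      (f := fun s : ℝ => E.pos v + s • (E.pos yi - E.pos v)) (hline s))).continuousWithinAt)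
    (by
      intro s hs
      have hs1 : (0 : ℝ) < 1 - s := by linarith [hs.2]
      have harg : (toC (E.pos yi) - toC (E.pos v + s • (E.pos yi - E.pos v))).arg =
          (toC (E.pos yi - E.pos v)).arg := by
        rw [← Complex.arg_real_mul (toC (E.pos yi - E.pos v)) hs1]
        congr 1
        simp only [map_add, map_sub, map_smul, Complex.real_smul]
        push_cast
        ring
      rw [Real.Angle.coe_sub, E.coe_walkAngle (hoff s hs) Wi hSi,
        E.coe_walkAngle (hoff s hs) Wj hSj, harg]
      abel)
  simp only [zero_smul, add_zero] at h1
  have hoffq := hoff (1 / 2) ⟨by norm_num, le_rfl⟩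
  have hkc : ContinuousAt (fun p => E.walkAngle Wi p - E.walkAngle Wj p -
      viewAngle (E.pos v) (E.pos yj) p) (E.mid v yi) :=
    ((E.continuousAt_walkAngle hoffq Wi hSi).sub (E.continuousAt_walkAngle hoffq Wj hSj)).sub
      (continuousAt_viewAngle (E.notMem_seg_of_mem_seg hi hj hne
        (add_smul_mem_seg (by norm_num) (by norm_num)) (add_smul_ne_left hposy (by norm_num))))
  have hpi := Real.pi_pos
  filter_upwards [eventually_eq_add_pi hkc h2 (B := Real.pi) (by linarith)] with p hp hoffp
  have hang : ((E.walkAngle (.cons hi Wi) p - E.walkAngle (.cons hj Wj) p : ℝ) :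
      Real.Angle) = 0 := by
    rw [Real.Angle.coe_sub, E.coe_walkAngle hoffp _ (fun _ _ => mem_univ _),
      E.coe_walkAngle hoffp _ (fun _ _ => mem_univ _), sub_self]
  have hsum : E.walkAngle (.cons hi Wi) p - E.walkAngle (.cons hj Wj) p =
      viewAngle (E.pos v) (E.pos yi) p + (E.walkAngle Wi p - E.walkAngle Wj p -
        viewAngle (E.pos v) (E.pos yj) p) := by
    simp only [walkAngle]; ring
  rw [hsum] at hang ⊢
  rw [hp _ (abs_viewAngle_le _ _ _) hang, ← h1]
  rfl

lemma eventually_vertex (E : PlaneEmb G) {v x yj r : V} (hx : G.Adj v x) (hr : G.Adj x r)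
    (hj : G.Adj v yj) (hvr : v ≠ r) (Wj : G.Walk yj r) (hvj : v ∉ Wj.support)
    (hxj : x ∉ Wj.support) :
    ∀ᶠ p in 𝓝 (E.pos x), E.Off univ p →
      E.walkAngle (.cons hx (.cons hr .nil)) p - E.walkAngle (.cons hj Wj) p =
        viewAngle (E.pos x) (E.pos r) (E.pos v) - E.walkAngle Wj (E.pos v) -
          (-(toC (E.pos yj - E.pos v) / toC (E.pos x - E.pos v))).arg +
          (if 0 ≤ viewAngle (E.pos v) (E.pos x) p + viewAngle (E.pos x) (E.pos r) p -
            (toC (E.pos r - E.pos x) / toC (E.pos x - E.pos v)).arg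
            then Real.pi else -Real.pi) := by
  have hne : x ≠ yj := fun e => hxj (e ▸ Wj.start_mem_support)
  have hposx : E.pos v ≠ E.pos x := fun h => hx.ne (E.inj h)
  have hd : toC (E.pos x - E.pos v) ≠ 0 := by
    rw [map_sub]; exact toC_sub_ne_zero hposx.symm
  have hSj : ∀ c ∈ Wj.support, c ∈ ({v, x}ᶜ : Set V) := by
    rintro c hc (rfl | rfl)
    exacts [hvj hc, hxj hc]
  have hoff : ∀ s ∈ Icc (0 : ℝ) 1, E.Off {v, x}ᶜ (E.pos v + s • (E.pos x - E.pos v)) := by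
    intro s hs
    rcases eq_or_ne s 1 with rfl | h1
    · rw [one_smul, add_sub_cancel]
      exact E.off_vertex (by simp)
    · exact E.off_edge (by simp) hx (add_smul_mem_seg hs.1 hs.2) (add_smul_ne_right hposx h1)
  have hline : ∀ s : ℝ, ContinuousAt (fun s : ℝ => E.pos v + s • (E.pos x - E.pos v)) s :=
    fun s => by fun_prop
  have hw : ∀ s : ℝ, toC (E.pos r - E.pos x) + (1 - s) * toC (E.pos x - E.pos v) =
      toC (E.pos r) - toC (E.pos v + s • (E.pos x - E.pos v)) := by
    intro s
    simp only [map_add, map_sub, map_smul, Complex.real_smul]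
    ring
  have hslit1 : toC (E.pos r - E.pos x) / toC (E.pos x - E.pos v) ∈ Complex.slitPlane := by
    have := neg_div_mem_slitPlane (E.vertex_off hx.symm hr.ne' hvr.symm)
      (E.vertex_off hr hx.ne hvr)
    rwa [← div_neg, ← map_neg, neg_sub] at this
  have hslit : ∀ s ∈ Icc (0 : ℝ) 1, (toC (E.pos r - E.pos x) + (1 - s) * toC (E.pos x - E.pos v)) /
      toC (E.pos x - E.pos v) ∈ Complex.slitPlane := by
    intro s hs
    rcases eq_or_lt_of_le hs.2 with h1 | h1
    · simpa [h1] using hslit1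
    · have hmem : E.pos v + s • (E.pos x - E.pos v) ∉ seg (E.pos x) (E.pos r) :=
        (E.off_edge (S := {x, r}) (by simp [hx.ne, hvr]) hx (add_smul_mem_seg hs.1 hs.2)
          (add_smul_ne_right hposx h1.ne)).2 x (by simp) r (by simp) hr
      rw [Complex.mem_slitPlane_iff_arg, ← viewAngle_of_right h1]
      refine ⟨(Complex.mem_slitPlane_iff_arg.1 (viewAngle_mem_slitPlane hmem)).1, ?_⟩
      rw [hw]
      refine div_ne_zero (toC_sub_ne_zero fun e => hmem ?_) hd
      rw [← e]; exact right_mem_seg _ _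
  obtain ⟨h1, h2⟩ := E.sub_viewAngle_eq hx hj hne
    (Q := fun s => ((toC (E.pos r - E.pos x) + (1 - s) * toC (E.pos x - E.pos v)) /
      toC (E.pos x - E.pos v)).arg -
      E.walkAngle Wj (E.pos v + s • (E.pos x - E.pos v))) (c := 1) one_pos le_rfl
    (fun s hs => ((ContinuousAt.comp (g := Complex.arg)
      (f := fun s : ℝ => (toC (E.pos r - E.pos x) + (1 - s) * toC (E.pos x - E.pos v)) /
      toC (E.pos x - E.pos v)) (Complex.continuousAt_arg (hslit s hs)) (by fun_prop)).sub
      ((E.continuousAt_walkAngle (hoff s hs) Wj hSj).comp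
      (f := fun s : ℝ => E.pos v + s • (E.pos x - E.pos v)) (hline s))).continuousWithinAt)
    (by
      intro s hs
      have hw0 : toC (E.pos r) - toC (E.pos v + s • (E.pos x - E.pos v)) ≠ 0 := by
        have := Complex.slitPlane_ne_zero (hslit s hs)
        rw [hw] at this
        exact fun e => this (by rw [e, zero_div])
      rw [Real.Angle.coe_sub, hw, Complex.arg_div_coe_angle hw0 hd,
        E.coe_walkAngle (hoff s hs) Wj hSj]
      abel)
  have hv0 : ((toC (E.pos r - E.pos x) + (1 - (0 : ℝ)) * toC (E.pos x - E.pos v)) /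
      toC (E.pos x - E.pos v)).arg = viewAngle (E.pos x) (E.pos r) (E.pos v) := by
    rw [← viewAngle_of_right one_pos, zero_smul, add_zero]
  have hv1 : (toC (E.pos r - E.pos x) + (1 - (1 : ℝ)) * toC (E.pos x - E.pos v)) /
      toC (E.pos x - E.pos v) = toC (E.pos r - E.pos x) / toC (E.pos x - E.pos v) := by
    simp
  simp only [hv0, hv1, zero_smul, add_zero, one_smul, add_sub_cancel] at h1 h2
  have hoffq : E.Off {v, x}ᶜ (E.pos x) := E.off_vertex (by simp)
  have hkc : ContinuousAt (fun p => (toC (E.pos r - E.pos x) / toC (E.pos x - E.pos v)).arg -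
      E.walkAngle Wj p - viewAngle (E.pos v) (E.pos yj) p) (E.pos x) :=
    (continuousAt_const.sub (E.continuousAt_walkAngle hoffq Wj hSj)).sub
      (continuousAt_viewAngle (E.vertex_off hj hx.ne' hne))
  have hpi := Real.pi_pos
  have hlt : |(toC (E.pos r - E.pos x) / toC (E.pos x - E.pos v)).arg| < Real.pi :=
    abs_lt.2 ⟨Complex.neg_pi_lt_arg _, lt_of_le_of_ne (Complex.arg_le_pi _)
      (Complex.mem_slitPlane_iff_arg.1 hslit1).1⟩
  filter_upwards [eventually_eq_add_pi hkc h2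
    (B := 2 * Real.pi + |(toC (E.pos r - E.pos x) / toC (E.pos x - E.pos v)).arg|)
    (by linarith)] with p hp hoffp
  have hang : ((E.walkAngle (.cons hx (.cons hr .nil)) p - E.walkAngle (.cons hj Wj) p : ℝ) :
      Real.Angle) = 0 := by
    rw [Real.Angle.coe_sub, E.coe_walkAngle hoffp _ (fun _ _ => mem_univ _),
      E.coe_walkAngle hoffp _ (fun _ _ => mem_univ _), sub_self]
  have hsum : E.walkAngle (.cons hx (.cons hr .nil)) p - E.walkAngle (.cons hj Wj) p =
      (viewAngle (E.pos v) (E.pos x) p + viewAngle (E.pos x) (E.pos r) p -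
        (toC (E.pos r - E.pos x) / toC (E.pos x - E.pos v)).arg) +
      ((toC (E.pos r - E.pos x) / toC (E.pos x - E.pos v)).arg -
      E.walkAngle Wj p - viewAngle (E.pos v) (E.pos yj) p) := by
    simp only [walkAngle]; ring
  rw [hsum] at hang ⊢
  rw [hp _ ?_ hang, ← h1]
  have b1 := abs_viewAngle_le (E.pos v) (E.pos x) p
  have b2 := abs_viewAngle_le (E.pos x) (E.pos r) p
  have b3 := abs_sub (viewAngle (E.pos v) (E.pos x) p + viewAngle (E.pos x) (E.pos r) p)
    (toC (E.pos r - E.pos x) / toC (E.pos x - E.pos v)).arg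
  have b4 := abs_add_le (viewAngle (E.pos v) (E.pos x) p) (viewAngle (E.pos x) (E.pos r) p)
  linarith

lemma walkAngle_sub_eq (E : PlaneEmb G) {F : Set (ℝ × ℝ)} (hF : IsPreconnected F)
    {S : Set V} (hoff : ∀ p ∈ F, E.Off S p) {a b : V} (W W' : G.Walk a b)
    (hW : ∀ c ∈ W.support, c ∈ S) (hW' : ∀ c ∈ W'.support, c ∈ S) {p q : ℝ × ℝ}
    (hp : p ∈ F) (hq : q ∈ F) :
    E.walkAngle W p - E.walkAngle W' p = E.walkAngle W q - E.walkAngle W' q := by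
  refine eq_of_coe_angle_eq (f := fun p => E.walkAngle W p - E.walkAngle W' p) (θ := 0) hF
    (fun p hp => ((E.continuousAt_walkAngle (hoff p hp) W hW).sub
      (E.continuousAt_walkAngle (hoff p hp) W' hW')).continuousWithinAt) ?_ hp hq
  intro p hp
  rw [Real.Angle.coe_sub, E.coe_walkAngle (hoff p hp) W hW, E.coe_walkAngle (hoff p hp) W' hW',
    sub_self]

lemma arg_neg_div_add (E : PlaneEmb G) {v y j : V} (hy : G.Adj v y) (hj : G.Adj v j)
    (hne : y ≠ j) :
    (-(toC (E.pos j - E.pos v) / toC (E.pos y - E.pos v))).arg +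
      (-(toC (E.pos y - E.pos v) / toC (E.pos j - E.pos v))).arg = 0 := by
  have h := neg_div_mem_slitPlane (E.vertex_off hy hj.ne' hne.symm) (E.vertex_off hj hy.ne' hne)
  have h2 : -(toC (E.pos y - E.pos v) / toC (E.pos j - E.pos v)) =
      (-(toC (E.pos j - E.pos v) / toC (E.pos y - E.pos v)))⁻¹ := by
    rw [← neg_inv, inv_div]
  rw [h2, Complex.arg_inv, if_neg (Complex.mem_slitPlane_iff_arg.1 h).1, add_neg_cancel]

lemma mid_mem_seg (E : PlaneEmb G) (v y : V) : E.mid v y ∈ seg (E.pos v) (E.pos y) :=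
  add_smul_mem_seg (by norm_num) (by norm_num)

/-- A single face cannot touch all three branches of a theta graph with branch vertices `v`
and `r`, one of the branches being the path `v x r`. -/
lemma not_touch_three (E : PlaneEmb G) {F : Set (ℝ × ℝ)} (hF : IsPreconnected F)
    (hoff : ∀ p ∈ F, E.Off univ p) {v v0 v2 x r : V} (h0 : G.Adj v v0) (h2 : G.Adj v v2)
    (hx : G.Adj v x) (hr : G.Adj x r) (h02 : v0 ≠ v2) (W0 : G.Walk v0 r) (W2 : G.Walk v2 r)
    (hv0 : v ∉ W0.support) (hv2 : v ∉ W2.support) (hx0 : x ∉ W0.support)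
    (hx2 : x ∉ W2.support) (hb0 : seg (E.pos v) (E.pos v0) ⊆ closure F)
    (hb2 : seg (E.pos v) (E.pos v2) ⊆ closure F) (hxF : E.pos x ∈ closure F) : False := by
  have hvr : v ≠ r := fun e => hv0 (e ▸ W0.end_mem_support)
  have hx0' : v0 ≠ x := fun e => hx0 (e ▸ W0.start_mem_support)
  have hx2' : v2 ≠ x := fun e => hx2 (e ▸ W2.start_mem_support)
  have hv1 : v ∉ (SimpleGraph.Walk.cons hr .nil).support := by simp [hx.ne, hvr]
  obtain ⟨p0, hp0, ⟨e01, e02⟩⟩ := ((mem_closure_iff_frequently.1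
    (hb0 (E.mid_mem_seg v v0))).and_eventually
    ((E.eventually_edge h0 hx hx0' W0 (.cons hr .nil) hv0 hv1).and
      (E.eventually_edge h0 h2 h02 W0 W2 hv0 hv2))).exists
  obtain ⟨p2, hp2, ⟨e21, e20⟩⟩ := ((mem_closure_iff_frequently.1
    (hb2 (E.mid_mem_seg v v2))).and_eventually
    ((E.eventually_edge h2 hx hx2' W2 (.cons hr .nil) hv2 hv1).and
      (E.eventually_edge h2 h0 h02.symm W2 W0 hv2 hv0))).exists
  obtain ⟨p1, hp1, ⟨e10, e12⟩⟩ := ((mem_closure_iff_frequently.1 hxF).and_eventually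
    ((E.eventually_vertex hx hr h0 hvr W0 hv0 hx0).and
      (E.eventually_vertex hx hr h2 hvr W2 hv2 hx2))).exists
  specialize e01 (hoff _ hp0)
  specialize e02 (hoff _ hp0)
  specialize e10 (hoff _ hp1)
  specialize e12 (hoff _ hp1)
  specialize e20 (hoff _ hp2)
  specialize e21 (hoff _ hp2)
  have c01 := E.walkAngle_sub_eq hF hoff (.cons h0 W0) (.cons hx (.cons hr .nil))
    (fun _ _ => mem_univ _) (fun _ _ => mem_univ _) hp0 hp1
  have c02 := E.walkAngle_sub_eq hF hoff (.cons h0 W0) (.cons h2 W2)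
    (fun _ _ => mem_univ _) (fun _ _ => mem_univ _) hp0 hp2
  have c12 := E.walkAngle_sub_eq hF hoff (.cons hx (.cons hr .nil)) (.cons h2 W2)
    (fun _ _ => mem_univ _) (fun _ _ => mem_univ _) hp1 hp2
  have a01 := E.arg_neg_div_add h0 hx hx0'
  have a02 := E.arg_neg_div_add h0 h2 h02
  have a12 := E.arg_neg_div_add hx h2 hx2'.symm
  have t1 : E.walkAngle (.cons hr .nil) (E.pos v) =
      viewAngle (E.pos x) (E.pos r) (E.pos v) := by simp [walkAngle]
  rw [t1] at e01 e21
  have hpi := Real.pi_pos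
  split_ifs at e01 e02 e10 e12 e20 e21 <;> linarith

end PlaneEmb

lemma isCompact_seg (a b : ℝ × ℝ) : IsCompact (seg a b) := by
  rw [seg, segment_eq_image']
  exact isCompact_Icc.image (by fun_prop)

lemma isPreconnected_seg (a b : ℝ × ℝ) : IsPreconnected (seg a b) :=
  (convex_segment a b).isPreconnected

namespace PlaneEmb

/-- The vertices of `S` together with the edges between them, except those joining `v`
and `x`. -/
def drawingExcept (E : PlaneEmb G) (S : Set V) (v x : V) : Set (ℝ × ℝ) :=
  (⋃ c ∈ S, {E.pos c}) ∪
    ⋃ a ∈ S, ⋃ b ∈ S, ⋃ (_ : G.Adj a b ∧ s(a, b) ≠ s(v, x)), seg (E.pos a) (E.pos b)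

lemma isClosed_drawingExcept [Finite V] (E : PlaneEmb G) (S : Set V) (v x : V) :
    IsClosed (E.drawingExcept S v x) := by
  refine ((Set.toFinite S).isClosed_biUnion fun c _ => isClosed_singleton).union
    ((Set.toFinite S).isClosed_biUnion fun a _ => (Set.toFinite S).isClosed_biUnion
      fun b _ => isClosed_iUnion_of_finite fun _ => (isCompact_seg _ _).isClosed)

lemma off_of_notMem_drawingExcept (E : PlaneEmb G) {S : Set V} {v x : V} {p : ℝ × ℝ}
    (hp : p ∉ E.drawingExcept S v x) (hp' : p ∉ seg (E.pos v) (E.pos x)) : E.Off S p := by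
  simp only [drawingExcept, mem_union, mem_iUnion, mem_singleton_iff, not_or, not_exists] at hp
  refine ⟨fun c hc h => hp.1 c hc h.symm, fun a ha b hb hab hpab => ?_⟩
  by_cases h : s(a, b) = s(v, x)
  · rcases Sym2.eq_iff.1 h with ⟨rfl, rfl⟩ | ⟨rfl, rfl⟩
    · exact hp' hpab
    · rw [seg, segment_symm] at hp'
      exact hp' hpab
  · exact hp.2 a ha b hb ⟨hab, h⟩ hpab

lemma isOpen_off [Finite V] (E : PlaneEmb G) (S : Set V) : IsOpen {p | E.Off S p} := by
  have : {p | E.Off S p} = ((⋃ c ∈ S, {E.pos c}) ∪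
      ⋃ a ∈ S, ⋃ b ∈ S, ⋃ (_ : G.Adj a b), seg (E.pos a) (E.pos b))ᶜ := by
    ext p
    simp only [Off, mem_ofPred_eq, mem_compl_iff, mem_union, mem_iUnion, mem_singleton_iff,
      not_or, not_exists, @eq_comm _ p]
  rw [this]
  exact (((Set.toFinite S).isClosed_biUnion fun c _ => isClosed_singleton).union
    ((Set.toFinite S).isClosed_biUnion fun a _ => (Set.toFinite S).isClosed_biUnion
      fun b _ => isClosed_iUnion_of_finite fun _ => (isCompact_seg _ _).isClosed)).isOpen_compl

/-- The face containing `q` of the drawing of the subgraph induced by `S`. -/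
def region (E : PlaneEmb G) (S : Set V) (q : ℝ × ℝ) : Set (ℝ × ℝ) :=
  connectedComponentIn {p | E.Off S p} q

lemma off_of_mem_region (E : PlaneEmb G) {S : Set V} {p q : ℝ × ℝ} (h : p ∈ E.region S q) :
    E.Off S p :=
  (connectedComponentIn_subset {p | E.Off S p} q h : _)

lemma isPreconnected_region (E : PlaneEmb G) (S : Set V) (q : ℝ × ℝ) :
    IsPreconnected (E.region S q) :=
  isPreconnected_connectedComponentIn

lemma subset_region (E : PlaneEmb G) {S : Set V} {p q : ℝ × ℝ} {T : Set (ℝ × ℝ)}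
    (hp : p ∈ E.region S q) (hT : IsPreconnected T) (hpT : p ∈ T) (hoff : ∀ c ∈ T, E.Off S c) :
    T ⊆ E.region S q := by
  rw [region, connectedComponentIn_eq hp]
  exact hT.subset_connectedComponentIn hpT hoff

lemma mem_region_of_mem_closure (E : PlaneEmb G) {S : Set V} {p q : ℝ × ℝ}
    (hp : p ∈ closure (E.region S q)) (hoff : E.Off S p) : p ∈ E.region S q := by
  obtain ⟨c, hc⟩ := closure_nonempty_iff.1 ⟨p, hp⟩
  refine E.subset_region hc ((E.isPreconnected_region S q).subset_closure
    (subset_insert p _) (insert_subset hp subset_closure)) (mem_insert_of_mem _ hc) ?_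
    (mem_insert _ _)
  rintro d (rfl | hd)
  exacts [hoff, E.off_of_mem_region hd]

lemma off_seg (E : PlaneEmb G) {S : Set V} {a b : V} (ha : a ∉ S) (hb : b ∉ S) (h : G.Adj a b)
    {p : ℝ × ℝ} (hp : p ∈ seg (E.pos a) (E.pos b)) : E.Off S p := by
  by_cases hpb : p = E.pos b
  · exact hpb ▸ E.off_vertex hb
  · exact E.off_edge ha h hp hpb

lemma seg_subset_region (E : PlaneEmb G) {S : Set V} {a b : V} (ha : a ∉ S) (hb : b ∉ S)
    (h : G.Adj a b) {p q : ℝ × ℝ} (hp : p ∈ E.region S q) (hpab : p ∈ seg (E.pos a) (E.pos b)) :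
    seg (E.pos a) (E.pos b) ⊆ E.region S q :=
  E.subset_region hp (isPreconnected_seg _ _) hpab fun _ hc => E.off_seg ha hb h hc

lemma walk_mem_region (E : PlaneEmb G) {S : Set V} {q : ℝ × ℝ} {a b : V} (W : G.Walk a b)
    (hW : ∀ c ∈ W.support, c ∉ S) (ha : E.pos a ∈ E.region S q) : E.pos b ∈ E.region S q := by
  induction W with
  | nil => exact ha
  | cons h W ih =>
    refine ih (fun c hc => hW c (by simp [hc])) ?_
    exact E.seg_subset_region (hW _ (by simp)) (hW _ (by simp)) h ha (left_mem_seg _ _)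
      (right_mem_seg _ _)

/-- The part of an edge off its first end. -/
lemma edge_subset_region (E : PlaneEmb G) {S : Set V} {v z : V} (hz : z ∉ S) (h : G.Adj v z)
    {q : ℝ × ℝ} (hzq : E.pos z ∈ E.region S q) {s : ℝ} (hs0 : 0 < s) (hs1 : s ≤ 1) :
    E.pos v + s • (E.pos z - E.pos v) ∈ E.region S q := by
  have hpos : E.pos v ≠ E.pos z := fun e => h.ne (E.inj e)
  have hseg : (fun s : ℝ => E.pos v + s • (E.pos z - E.pos v)) '' Ioc 0 1 ⊆ E.region S q := by
    refine E.subset_region hzq (isPreconnected_Ioc.image _ (by fun_prop))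
      ⟨1, by simp, by simp⟩ ?_
    rintro _ ⟨s, hs, rfl⟩
    refine E.off_edge hz h.symm ?_ (add_smul_ne_left hpos hs.1.ne')
    rw [seg, segment_symm]
    exact add_smul_mem_seg hs.1.le hs.2
  exact hseg ⟨s, ⟨hs0, hs1⟩, rfl⟩

lemma walkAngle_sub_eq_limit (E : PlaneEmb G) {S : Set V} {T : Set (ℝ × ℝ)}
    {v y y0 z : V} (hT : IsPreconnected T) (hoff : ∀ p ∈ T, E.Off (insert v S) p) (hvS : v ∉ S)
    (hzS : z ∉ S) (hz : G.Adj v z) (hy : G.Adj v y) (hy0 : G.Adj v y0) (W : G.Walk y y0)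
    (hW : ∀ c ∈ W.support, c ∈ S)
    (hzT : ∀ s : ℝ, 0 < s → s ≤ 1 → E.pos v + s • (E.pos z - E.pos v) ∈ T) {q : ℝ × ℝ}
    (hq : q ∈ T) :
    E.walkAngle (.cons hy W) q - viewAngle (E.pos v) (E.pos y0) q =
      (-(toC (E.pos y - E.pos v) / toC (E.pos z - E.pos v))).arg -
      (-(toC (E.pos y0 - E.pos v) / toC (E.pos z - E.pos v))).arg +
      E.walkAngle W (E.pos v) := by
  have hyS : y ∈ S := hW _ W.start_mem_support
  have hy0S : y0 ∈ S := hW _ W.end_mem_support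
  let f : V → ℝ → ℝ := fun j s =>
    (-((toC (E.pos j - E.pos v) - s * toC (E.pos z - E.pos v)) / toC (E.pos z - E.pos v))).arg
  have hf : ∀ j ∈ S, G.Adj v j → ContinuousAt (f j) 0 := by
    intro j hj hvj
    have hne : z ≠ j := fun e => hzS (e ▸ hj)
    refine ContinuousAt.comp (g := Complex.arg) (Complex.continuousAt_arg ?_) (by fun_prop)
    simpa using neg_div_mem_slitPlane (E.vertex_off hz hvj.ne' hne.symm)
        (E.vertex_off hvj hz.ne' hne)
  let g : ℝ → ℝ := fun s => f y s - f y0 s + E.walkAngle W (E.pos v + s • (E.pos z - E.pos v))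
  have hg : ContinuousAt g 0 := by
    refine ((hf y hyS hy).sub (hf y0 hy0S hy0)).add ?_
    refine ContinuousAt.comp (f := fun s : ℝ => E.pos v + s • (E.pos z - E.pos v)) ?_
      (by fun_prop)
    simp only [zero_smul, add_zero]
    exact E.continuousAt_walkAngle (E.off_vertex hvS) W hW
  have hconst : ∀ s ∈ Ioc (0 : ℝ) 1, g s =
      E.walkAngle (.cons hy W) q - viewAngle (E.pos v) (E.pos y0) q := by
    intro s hs
    have := E.walkAngle_sub_eq hT hoff (.cons hy W) (.cons hy0 .nil)
      (by simpa using fun c hc => Or.inr (hW c hc) : ∀ c ∈ (SimpleGraph.Walk.cons hy W).support, _) (by simp [hy0S]) (hzT s hs.1 hs.2) hq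
    simp only [walkAngle, add_zero] at this ⊢
    rw [← this, viewAngle_of_left hs.1, viewAngle_of_left hs.1]
    simp only [g, f]
    ring
  have h1 : Filter.Tendsto g (𝓝[>] 0) (𝓝 (g 0)) := hg.tendsto.mono_left nhdsWithin_le_nhds
  have h2 : Filter.Tendsto g (𝓝[>] 0)
      (𝓝 (E.walkAngle (.cons hy W) q - viewAngle (E.pos v) (E.pos y0) q)) := by
    refine tendsto_const_nhds.congr' ?_
    filter_upwards [Ioc_mem_nhdsGT one_pos] with s hs using (hconst s hs).symm
  rw [tendsto_nhds_unique h2 h1]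
  simp [g, f]

end PlaneEmb

lemma coe_arg_mul_exp {ρ : ℝ} (hρ : 0 < ρ) (θ : ℝ) :
    ((ρ * Complex.exp (θ * Complex.I) : ℂ).arg : Real.Angle) = θ := by
  have h := Complex.arg_mul_cos_add_sin_mul_I_coe_angle hρ (θ : Real.Angle)
  rw [Complex.exp_mul_I]
  rwa [Real.Angle.cos_coe, Real.Angle.sin_coe, Complex.ofReal_cos, Complex.ofReal_sin] at h

lemma ne_mul_of_arg_rotation {a b d : ℂ} (ha : -(d / a) ∈ Complex.slitPlane)
    (hb : -(d / b) ∈ Complex.slitPlane) {r t l : ℝ} (hr : 0 < r) (ht : 0 < t)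
    (hl : l ∈ Icc (0 : ℝ) 1) :
    r * a * Complex.exp ((l * ((-(d / a)).arg - (-(d / b)).arg) : ℝ) * Complex.I) ≠ t * d := by
  intro h
  have ha0 : a ≠ 0 := by
    rintro rfl
    simp at ha
  obtain ⟨θ, hθ⟩ : ∃ θ : ℝ, θ = l * ((-(d / a)).arg - (-(d / b)).arg) := ⟨_, rfl⟩
  rw [← hθ] at h
  have ht0 : (t : ℂ) ≠ 0 := by exact_mod_cast ht.ne'
  have e1 : -(d / a) = ((r / t : ℝ) : ℂ) * Complex.exp ((θ + Real.pi : ℝ) * Complex.I) := by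
    push_cast
    rw [add_mul, Complex.exp_add, Complex.exp_pi_mul_I]
    field_simp
    linear_combination h
  have e2 := coe_arg_mul_exp (div_pos hr ht) (θ + Real.pi)
  rw [← e1, Real.Angle.angle_eq_iff_two_pi_dvd_sub] at e2
  obtain ⟨k, hk⟩ := e2
  have a1 := Complex.neg_pi_lt_arg (-(d / a))
  have a2 := lt_of_le_of_ne (Complex.arg_le_pi _) (Complex.mem_slitPlane_iff_arg.1 ha).1
  have b1 := Complex.neg_pi_lt_arg (-(d / b))
  have b2 := lt_of_le_of_ne (Complex.arg_le_pi _) (Complex.mem_slitPlane_iff_arg.1 hb).1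
  have hpi := Real.pi_pos
  have c1 : (-(d / a)).arg - θ = (1 - l) * (-(d / a)).arg + l * (-(d / b)).arg := by
    rw [hθ]; ring
  have c2 : (-(d / a)).arg - θ < Real.pi := by
    rw [c1]
    rcases eq_or_lt_of_le hl.1 with h0 | h0
    · rw [← h0]; linarith
    · nlinarith [hl.2]
  have c3 : -Real.pi < (-(d / a)).arg - θ := by
    rw [c1]
    rcases eq_or_lt_of_le hl.1 with h0 | h0
    · rw [← h0]; linarith
    · nlinarith [hl.2]
  have k1 : (k : ℝ) < 0 := by
    by_contra hk0
    nlinarith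
  have k2 : (-1 : ℝ) < k := by
    by_contra hk0
    nlinarith
  have k1' : k < 0 := by exact_mod_cast k1
  have k2' : -1 < k := by exact_mod_cast k2
  omega

lemma ne_mul_self_of_lt_two_pi {a : ℂ} (ha : a ≠ 0) {r t θ : ℝ} (hr : 0 < r) (ht : 0 < t)
    (hθ : θ ≠ 0) (hθ2 : |θ| < 2 * Real.pi) : r * a * Complex.exp (θ * Complex.I) ≠ t * a := by
  intro h
  have ht0 : (t : ℂ) ≠ 0 := by exact_mod_cast ht.ne'
  have e1 : (1 : ℂ) = ((r / t : ℝ) : ℂ) * Complex.exp (θ * Complex.I) := by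
    push_cast
    field_simp
    have : (r * Complex.exp (θ * Complex.I) - t) * a = 0 := by linear_combination h
    rcases mul_eq_zero.1 this with h' | h'
    · rw [eq_comm]; linear_combination h'
    · exact absurd h' ha
  have e2 := coe_arg_mul_exp (div_pos hr ht) θ
  rw [← e1, Complex.arg_one, Real.Angle.angle_eq_iff_two_pi_dvd_sub] at e2
  obtain ⟨k, hk⟩ := e2
  have hpi := Real.pi_pos
  rw [abs_lt] at hθ2
  have k1 : (k : ℝ) < 1 := by nlinarith
  have k2 : (-1 : ℝ) < k := by nlinarith
  have k1' : k < 1 := by exact_mod_cast k1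
  have k2' : -1 < k := by exact_mod_cast k2
  have k0 : k = 0 := by omega
  rw [k0] at hk
  apply hθ
  simpa using hk

lemma exp_arg_sub_arg {a b d : ℂ} (ha : a ≠ 0) (hb : b ≠ 0) (hd : d ≠ 0) :
    a * Complex.exp (((-(d / a)).arg - (-(d / b)).arg : ℝ) * Complex.I) =
      (‖a‖ / ‖b‖ : ℝ) * b := by
  have h : ∀ z : ℂ, z ≠ 0 → Complex.exp (z.arg * Complex.I) = z / ‖z‖ := by
    intro z hz
    have nz : (‖z‖ : ℂ) ≠ 0 := by simpa using hz
    rw [eq_div_iff nz, mul_comm, Complex.norm_mul_exp_arg_mul_I]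
  have na : (‖a‖ : ℂ) ≠ 0 := by simpa using ha
  have nb : (‖b‖ : ℂ) ≠ 0 := by simpa using hb
  have nd : (‖d‖ : ℂ) ≠ 0 := by simpa using hd
  rw [Complex.ofReal_sub, sub_mul, Complex.exp_sub, h _ (neg_ne_zero.2 (div_ne_zero hd ha)),
    h _ (neg_ne_zero.2 (div_ne_zero hd hb)), norm_neg, norm_neg, norm_div, norm_div]
  push_cast
  field_simp

namespace PlaneEmb

lemma off_insert (E : PlaneEmb G) {S : Set V} {v : V} {p : ℝ × ℝ} (hp : E.Off S p)
    (hpv : p ≠ E.pos v) (h : ∀ y ∈ S, G.Adj v y → p ∉ seg (E.pos v) (E.pos y)) :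
    E.Off (insert v S) p := by
  refine ⟨?_, ?_⟩
  · rintro c (rfl | hc)
    exacts [hpv.symm, hp.1 c hc]
  · rintro a (rfl | ha) b (rfl | hb) hab
    · exact absurd rfl hab.ne
    · exact h b hb hab
    · rw [seg, segment_symm]
      exact h a ha hab.symm
    · exact hp.2 a ha b hb hab

/-- If the face touches an interior point of an edge, it touches the whole edge. -/
lemma seg_subset_closure_region [Finite V] (E : PlaneEmb G) {S : Set V} {v x : V} (hv : v ∈ S)
    (hx : x ∈ S) (h : G.Adj v x) {q : ℝ × ℝ} {r : ℝ} (hr0 : 0 < r) (hr1 : r < 1)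
    (hr : E.pos v + r • (E.pos x - E.pos v) ∈ closure (E.region S q)) :
    seg (E.pos v) (E.pos x) ⊆ closure (E.region S q) := by
  have hpos : E.pos v ≠ E.pos x := fun e => h.ne (E.inj e)
  let f : ℝ → ℝ × ℝ := fun s => E.pos v + s • (E.pos x - E.pos v)
  have hf : Continuous f := by fun_prop
  have hK := E.isClosed_drawingExcept S v x
  have hvK : E.pos v ∈ E.drawingExcept S v x :=
    Or.inl (mem_biUnion hv rfl)
  have hxK : E.pos x ∈ E.drawingExcept S v x :=
    Or.inl (mem_biUnion hx rfl)
  have hoffK : ∀ t ∈ Ioo (0 : ℝ) 1, f t ∉ E.drawingExcept S v x := by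
    rintro t ht (hc | hc)
    · simp only [mem_iUnion, mem_singleton_iff] at hc
      obtain ⟨c, -, hc⟩ := hc
      have hmem : E.pos c ∈ seg (E.pos v) (E.pos x) :=
        hc ▸ add_smul_mem_seg ht.1.le ht.2.le
      refine E.vertex_off h (v := c) ?_ ?_ hmem
      · rintro rfl
        exact add_smul_ne_left hpos ht.1.ne' hc
      · rintro rfl
        exact add_smul_ne_right hpos ht.2.ne hc
    · simp only [mem_iUnion] at hc
      obtain ⟨a, -, b, -, ⟨hab, hne⟩, hc⟩ := hc
      obtain ⟨-, h1⟩ := E.edges_meet hab h hne ⟨hc, add_smul_mem_seg ht.1.le ht.2.le⟩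
      rcases h1 with h1 | h1
      · exact add_smul_ne_left hpos ht.1.ne' h1
      · exact add_smul_ne_right hpos ht.2.ne h1
  have main : ∀ t ∈ Ioo (0 : ℝ) 1, f t ∈ closure (E.region S q) := by
    intro t ht
    have hsub : f '' uIcc r t ⊆ (E.drawingExcept S v x)ᶜ := by
      rintro _ ⟨s, hs, rfl⟩
      exact hoffK s (ordConnected_Ioo.uIcc_subset ⟨hr0, hr1⟩ ht hs)
    obtain ⟨δ, hδ, hδK⟩ := (isCompact_uIcc.image hf).exists_thickening_subset_open
      hK.isOpen_compl hsub
    have hball : ∀ s ∈ uIcc r t, ∀ p, dist p (f s) < δ → p ∉ E.drawingExcept S v x :=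
      fun s hs p hp => hδK (Metric.mem_thickening_iff.2 ⟨f s, ⟨s, hs, rfl⟩, hp⟩)
    rw [Metric.mem_closure_iff] at hr ⊢
    intro ε hε
    obtain ⟨p, hp, hpr⟩ := hr (min δ ε) (lt_min hδ hε)
    rw [dist_comm] at hpr
    have hpline : ∀ s : ℝ, p ≠ f s := by
      intro s hs
      have hseg : ∀ u ∈ uIcc s r, f u ∉ E.drawingExcept S v x := by
        intro u hu
        refine hball r left_mem_uIcc _ (lt_of_le_of_lt ?_ (hpr.trans_le (min_le_left _ _)))
        rw [hs, dist_eq_norm, dist_eq_norm]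
        have e : ∀ u, f u - f r = (u - r) • (E.pos x - E.pos v) := by
          intro u; simp only [f]; rw [sub_smul]; abel
        rw [e, e, norm_smul, norm_smul]
        refine mul_le_mul_of_nonneg_right ?_ (norm_nonneg _)
        rw [Real.norm_eq_abs, Real.norm_eq_abs]
        rw [abs_sub_comm, abs_sub_comm s]
        exact abs_sub_right_of_mem_uIcc hu
      rcases lt_or_ge s 0 with h0 | h0
      · exact hseg 0 (mem_uIcc.2 (Or.inl ⟨h0.le, hr0.le⟩)) (by simpa [f] using hvK)
      rcases lt_or_ge 1 s with h1 | h1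
      · exact hseg 1 (mem_uIcc.2 (Or.inr ⟨hr1.le, h1.le⟩)) (by simpa [f] using hxK)
      · exact (E.off_of_mem_region hp).2 v hv x hx h (hs ▸ add_smul_mem_seg h0 h1)
    let g : ℝ → ℝ × ℝ := fun s => p + (s - r) • (E.pos x - E.pos v)
    have hgf : ∀ s, dist (g s) (f s) = dist p (f r) := by
      intro s
      rw [dist_eq_norm, dist_eq_norm]
      congr 1
      simp only [f, g]
      rw [sub_smul]; abel
    have hg : g '' uIcc r t ⊆ E.region S q := by
      refine E.subset_region hp (isPreconnected_uIcc.image _ (by fun_prop))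
        ⟨r, left_mem_uIcc, by simp [g]⟩ ?_
      rintro _ ⟨s, hs, rfl⟩
      refine E.off_of_notMem_drawingExcept (hball s hs _ ?_) ?_
      · rw [hgf]; exact hpr.trans_le (min_le_left _ _)
      · rw [seg, segment_eq_image']
        rintro ⟨u, -, hu⟩
        refine hpline (u - (s - r)) ?_
        simp only [f, g] at hu ⊢
        rw [sub_smul, ← add_sub_assoc, hu, add_sub_cancel_right]
    refine ⟨g t, hg ⟨t, right_mem_uIcc, rfl⟩, ?_⟩
    rw [dist_comm, hgf]
    exact hpr.trans_le (min_le_right _ _)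
  rw [seg, segment_eq_image', ← closure_Ioo zero_ne_one]
  exact (image_closure_subset_closure_image hf).trans
    (closure_minimal (image_subset_iff.2 main) isClosed_closure)

/-- Turning around `v` from an edge leading to the face towards `vx` without meeting an edge
to `B`, the face is seen to touch `vx`. -/
lemma seg_subset_closure_of_walk [Finite V] (E : PlaneEmb G) {B : Set V} {v x v0 v2 : V}
    {q : ℝ × ℝ} (hvB : v ∉ B) (hxB : x ∉ B) (h2B : v2 ∉ B) (h2x : v2 ≠ x) (hx : G.Adj v x)
    (h0 : G.Adj v v0) (h2 : G.Adj v v2) (h0B : v0 ∈ B)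
    (hconn : ∀ y ∈ B, G.Adj v y → ∃ W : G.Walk y v0, ∀ c ∈ W.support, c ∈ B)
    (W : G.Walk x v2) (hW : ∀ c ∈ W.support, c ∉ B ∧ c ≠ v)
    (h2F : E.pos v2 ∈ closure (E.region (insert v (insert x B)) q)) :
    seg (E.pos v) (E.pos x) ⊆ closure (E.region (insert v (insert x B)) q) := by
  obtain ⟨S, hS⟩ : ∃ S, S = insert v (insert x B) := ⟨_, rfl⟩
  rw [← hS] at h2F ⊢
  have h2S : v2 ∉ S := by
    rw [hS]
    rintro (e | e | e)
    exacts [h2.ne' e, h2x e, h2B e]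
  have hxi : x ∉ insert v B := by
    rintro (e | e)
    exacts [hx.ne' e, hxB e]
  have h2i : v2 ∉ insert v B := by
    rintro (e | e)
    exacts [h2.ne' e, h2B e]
  have hposx : E.pos v ≠ E.pos x := fun e => hx.ne (E.inj e)
  have hpos2 : E.pos v ≠ E.pos v2 := fun e => h2.ne (E.inj e)
  have hx2 : E.pos v2 ∈ E.region S q := E.mem_region_of_mem_closure h2F (E.off_vertex h2S)
  have hTx : E.pos x ∈ E.region (insert v B) (E.pos x) :=
    mem_connectedComponentIn (F := {p | E.Off (insert v B) p}) (E.off_vertex hxi)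
  have hT2 : E.pos v2 ∈ E.region (insert v B) (E.pos x) := by
    refine E.walk_mem_region W (fun c hc => ?_) hTx
    rintro (e | e)
    exacts [(hW c hc).2 e, (hW c hc).1 e]
  obtain ⟨dx, hdx⟩ : ∃ d, d = toC (E.pos x - E.pos v) := ⟨_, rfl⟩
  obtain ⟨d2, hd2⟩ : ∃ d, d = toC (E.pos v2 - E.pos v) := ⟨_, rfl⟩
  have hdx0 : dx ≠ 0 := by rw [hdx, map_sub]; exact toC_sub_ne_zero hposx.symm
  have hd20 : d2 ≠ 0 := by rw [hd2, map_sub]; exact toC_sub_ne_zero hpos2.symm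
  obtain ⟨κ, hκ⟩ : ∃ κ : ℝ, κ = (-(toC (E.pos v0 - E.pos v) / dx)).arg -
    (-(toC (E.pos v0 - E.pos v) / d2)).arg := ⟨_, rfl⟩
  have hslit : ∀ z, z ∉ B → G.Adj v z → ∀ y ∈ B, G.Adj v y →
      -(toC (E.pos y - E.pos v) / toC (E.pos z - E.pos v)) ∈ Complex.slitPlane := by
    intro z hz hvz y hy hvy
    have hne : z ≠ y := fun e => hz (e ▸ hy)
    exact neg_div_mem_slitPlane (E.vertex_off hvz hvy.ne' hne.symm) (E.vertex_off hvy hvz.ne' hne)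
  have hκy : ∀ y ∈ B, G.Adj v y → κ = (-(toC (E.pos y - E.pos v) / dx)).arg -
      (-(toC (E.pos y - E.pos v) / d2)).arg := by
    intro y hy hvy
    obtain ⟨Wy, hWy⟩ := hconn y hy hvy
    have l1 := E.walkAngle_sub_eq_limit (E.isPreconnected_region _ _)
      (fun _ => E.off_of_mem_region) hvB hxB hx hvy h0 Wy hWy
      (fun s => E.edge_subset_region hxi hx hTx) hTx
    have l2 := E.walkAngle_sub_eq_limit (E.isPreconnected_region _ _)
      (fun _ => E.off_of_mem_region) hvB h2B h2 hvy h0 Wy hWy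
      (fun s => E.edge_subset_region h2i h2 hT2) hTx
    rw [← hdx] at l1
    rw [← hd2] at l2
    linarith
  have hend : dx * Complex.exp (κ * Complex.I) = (‖dx‖ / ‖d2‖ : ℝ) * d2 := by
    rw [hκ]
    refine exp_arg_sub_arg hdx0 hd20 ?_
    rw [map_sub]
    exact toC_sub_ne_zero fun e => h0.ne' (E.inj e)
  have hκ0 : κ ≠ 0 := by
    intro h
    rw [h, Complex.ofReal_zero, zero_mul, Complex.exp_zero, mul_one] at hend
    have hs := neg_div_mem_slitPlane (E.vertex_off h2 hx.ne' h2x.symm) (E.vertex_off hx h2.ne' h2x)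
    rw [← hdx, ← hd2, hend, mul_div_assoc, div_self hd20, mul_one, ← Complex.ofReal_neg,
      Complex.ofReal_mem_slitPlane] at hs
    have : 0 ≤ ‖dx‖ / ‖d2‖ := by positivity
    linarith
  have hκ2 : |κ| < 2 * Real.pi := by
    have s1 := hslit x hxB hx v0 h0B h0
    have s2 := hslit v2 h2B h2 v0 h0B h0
    rw [← hdx] at s1
    rw [← hd2] at s2
    have a1 := Complex.neg_pi_lt_arg (-(toC (E.pos v0 - E.pos v) / dx))
    have a2 := lt_of_le_of_ne (Complex.arg_le_pi _) (Complex.mem_slitPlane_iff_arg.1 s1).1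
    have b1 := Complex.neg_pi_lt_arg (-(toC (E.pos v0 - E.pos v) / d2))
    have b2 := lt_of_le_of_ne (Complex.arg_le_pi _) (Complex.mem_slitPlane_iff_arg.1 s2).1
    rw [abs_lt]
    constructor <;> linarith
  have hcont : ContinuousAt (fun z : ℂ => toC.symm (toC (E.pos v) + z)) 0 := by
    have := toC.symm.continuous
    fun_prop
  have hU : {p | E.Off (insert x B) p} ∈ 𝓝 (toC.symm (toC (E.pos v) + 0)) := by
    rw [add_zero, ContinuousLinearEquiv.symm_apply_apply]
    refine (E.isOpen_off _).mem_nhds (E.off_vertex ?_)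
    rintro (e | e)
    exacts [hx.ne e, hvB e]
  obtain ⟨ε, hε, hεU⟩ := Metric.eventually_nhds_iff.1 (hcont.eventually hU)
  have hnx : 0 < ‖dx‖ := norm_pos_iff.2 hdx0
  have hn2 : 0 < ‖d2‖ := norm_pos_iff.2 hd20
  obtain ⟨r, hr0, hr⟩ := exists_between (show (0 : ℝ) < min 1 (min (ε / ‖dx‖) (‖d2‖ / ‖dx‖)) from
    lt_min one_pos (lt_min (by positivity) (by positivity)))
  have hr1 : r < 1 := hr.trans_le (min_le_left _ _)
  have hrε : r * ‖dx‖ < ε := (lt_div_iff₀ hnx).1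
    (hr.trans_le ((min_le_right _ _).trans (min_le_left _ _)))
  have hr2 : r * ‖dx‖ < ‖d2‖ := (lt_div_iff₀ hnx).1
    (hr.trans_le ((min_le_right _ _).trans (min_le_right _ _)))
  let z : ℝ → ℂ := fun l => r * dx * Complex.exp ((l * κ : ℝ) * Complex.I)
  let γ : ℝ → ℝ × ℝ := fun l => toC.symm (toC (E.pos v) + z l)
  have hγ : Continuous γ := toC.symm.continuous.comp (by fun_prop)
  have hz0 : ∀ l, z l ≠ 0 := fun l =>
    mul_ne_zero (mul_ne_zero (by exact_mod_cast hr0.ne') hdx0) (Complex.exp_ne_zero _)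
  have hline : ∀ (l t : ℝ) (y : V), γ l = E.pos v + t • (E.pos y - E.pos v) ↔
      z l = t * toC (E.pos y - E.pos v) := by
    intro l t y
    rw [← toC.injective.eq_iff]
    simp only [γ, ContinuousLinearEquiv.apply_symm_apply, map_add, map_smul,
      Complex.real_smul, add_right_inj]
  have hoff : ∀ l ∈ Ioc (0 : ℝ) 1, E.Off S (γ l) := by
    intro l hl
    rw [hS]
    refine E.off_insert (hεU ?_) ?_ ?_
    · rw [dist_zero_right]
      simp only [z]
      rw [norm_mul, Complex.norm_exp_ofReal_mul_I, mul_one, norm_mul, Complex.norm_real,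
        Real.norm_eq_abs, abs_of_pos hr0]
      exact hrε
    · intro h
      have := (hline l 0 v).1 (by simpa using h)
      exact hz0 l (by simpa using this)
    · intro y hy hvy hmem
      rw [seg, segment_eq_image'] at hmem
      obtain ⟨t, ht, hty⟩ := hmem
      have ht2 := (hline l t y).1 hty.symm
      have ht0 : 0 < t := by
        refine lt_of_le_of_ne ht.1 ?_
        rintro rfl
        exact hz0 l (by simpa using ht2)
      rcases hy with rfl | hy
      · rw [← hdx] at ht2
        refine ne_mul_self_of_lt_two_pi hdx0 hr0 ht0 (mul_ne_zero hl.1.ne' hκ0) ?_ ht2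
        rw [abs_mul, abs_of_pos hl.1]
        exact lt_of_le_of_lt (mul_le_of_le_one_left (abs_nonneg _) hl.2) hκ2
      · simp only [z] at ht2
        rw [hκy y hy hvy] at ht2
        exact ne_mul_of_arg_rotation (hdx ▸ hslit x hxB hx y hy hvy)
          (hd2 ▸ hslit v2 h2B h2 y hy hvy) hr0 ht0 ⟨hl.1.le, hl.2⟩ ht2
  have hγ1 : γ 1 ∈ E.region S q := by
    rw [(hline 1 (r * ‖dx‖ / ‖d2‖) v2).2 ?_]
    · exact E.edge_subset_region h2S h2 hx2 (by positivity) ((div_le_one hn2).2 hr2.le)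
    · simp only [z, one_mul]
      rw [mul_assoc, hend, ← hd2]
      push_cast
      ring
  have hγF : γ '' Ioc 0 1 ⊆ E.region S q :=
    E.subset_region hγ1 (isPreconnected_Ioc.image _ hγ.continuousOn) ⟨1, by simp, rfl⟩ (by
      rintro _ ⟨l, hl, rfl⟩
      exact hoff l hl)
  have hγ0 : γ 0 ∈ closure (E.region S q) := by
    refine closure_mono hγF (image_closure_subset_closure_image hγ ⟨0, ?_, rfl⟩)
    rw [closure_Ioc zero_ne_one]
    exact ⟨le_rfl, zero_le_one⟩
  rw [(hline 0 r x).2 (by simp [z, hdx])] at hγ0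
  exact E.seg_subset_closure_region (hS ▸ mem_insert _ _)
    (hS ▸ mem_insert_of_mem _ (mem_insert _ _)) hx hr0 hr1 hγ0

end PlaneEmb

/-- The plane embedding of a subgraph induced by a plane embedding of a graph. -/
def PlaneEmb.comap (E : PlaneEmb G) {U : Type} {H : SimpleGraph U} (ι : U → V)
    (hι : Function.Injective ι) (hH : ∀ ⦃i j⦄, H.Adj i j → G.Adj (ι i) (ι j)) : PlaneEmb H where
  pos i := E.pos (ι i)
  inj := E.inj.comp hι
  edges_meet := fun a b c d hab hcd hne => by
    refine E.edges_meet (hH hab) (hH hcd) fun h => hne ?_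
    exact Sym2.map.injective hι h
  vertex_off := fun _ _ _ hab ha hb =>
    E.vertex_off (hH hab) (fun h => ha (hι h)) fun h => hb (hι h)

lemma PlaneEmb.comap_drawing_subset (E : PlaneEmb G) {U : Type} {H : SimpleGraph U} (ι : U → V)
    (hι : Function.Injective ι) (hH : ∀ ⦃i j⦄, H.Adj i j → G.Adj (ι i) (ι j)) :
    (E.comap ι hι hH).drawing ⊆ E.drawing := by
  refine union_subset_union (range_comp_subset_range ι E.pos) ?_
  refine iUnion_subset fun i => iUnion_subset fun j => iUnion_subset fun hij => ?_
  exact fun p hp => mem_iUnion.2 ⟨ι i, mem_iUnion.2 ⟨ι j, mem_iUnion.2 ⟨hH hij, hp⟩⟩⟩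

lemma PlaneEmb.notMem_drawing_iff (E : PlaneEmb G) {p : ℝ × ℝ} :
    p ∉ E.drawing ↔ E.Off univ p := by
  simp [PlaneEmb.drawing, PlaneEmb.Off]

lemma HasCycleLen.map {U : Type} {H : SimpleGraph U} {k : ℕ} (h : HasCycleLen H k) (ι : U → V)
    (hι : Function.Injective ι) (hH : ∀ ⦃i j⦄, H.Adj i j → G.Adj (ι i) (ι j)) :
    HasCycleLen G k := by
  obtain ⟨v, c, hc, hk⟩ := h
  let f : H →g G := ⟨ι, @fun _ _ h => hH h⟩
  exact ⟨_, c.map f, hc.map (f := f) hι, by rw [SimpleGraph.Walk.length_map, hk]⟩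

lemma hasCycleLen_four {a b c d : V} (hab : G.Adj a b) (hbc : G.Adj b c) (hcd : G.Adj c d)
    (hda : G.Adj d a) (hac : a ≠ c) (hbd : b ≠ d) : HasCycleLen G 4 := by
  refine ⟨a, .cons hab (.cons hbc (.cons hcd (.cons hda .nil))), ?_, rfl⟩
  rw [SimpleGraph.Walk.cons_isCycle_iff]
  have := hab.ne
  have := hbc.ne
  have := hcd.ne
  have := hda.ne
  simp only [SimpleGraph.Walk.isPath_def, SimpleGraph.Walk.support_cons,
    SimpleGraph.Walk.support_nil, SimpleGraph.Walk.edges_cons, SimpleGraph.Walk.edges_nil]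
  constructor
  · simp
    grind
  · simp
    grind

namespace Cfg4

/-- In a minimum counterexample, smaller configurations with shorter lists are colorable. -/
lemma MinCounterexample.colorable_of_lt {C : Cfg4} (hC : C.MinCounterexample) {m : ℕ}
    {H : SimpleGraph (Fin m)} (ι : Fin m → Fin C.n) (hι : Function.Injective ι)
    (hH : ∀ ⦃i j⦄, H.Adj i j → C.G.Adj (ι i) (ι j))
    (hlt : m + Nat.card H.edgeSet < C.measure) {q : ℝ × ℝ} (hq : q ∉ C.E.drawing)
    (hF : C.F = connectedComponentIn C.E.drawingᶜ q) (Q : List (Fin m)) (M : Fin m → Finset ℕ)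
    (hQn : Q.Nodup) (hQ3 : Q.length ≤ 3) (hQF : ∀ i ∈ Q, ι i ∈ C.E.onFace C.F)
    (hQc : Q.IsChain ((C.E.comap ι hι hH).BoundaryEdge
      (connectedComponentIn (C.E.comap ι hι hH).drawingᶜ q)))
    (hM : ∀ i, M i ⊆ C.L (ι i)) (hMin : ∀ i, ι i ∉ C.E.onFace C.F → 3 ≤ (M i).card)
    (hM2 : ∀ i, i ∉ Q → 2 ≤ (M i).card) (hM1 : ∀ i ∈ Q, (M i).card = 1)
    (hind : ∀ ⦃i j⦄, H.Adj i j → (M i).card = 2 → (M j).card ≠ 2)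
    (hφ : ∃ φ : Fin m → ℕ, (∀ i ∈ Q, φ i ∈ M i) ∧
      ∀ ⦃i j⦄, i ∈ Q → j ∈ Q → H.Adj i j → φ i ≠ φ j)
    (htwo : ∀ x, (M x).card = 2 → ∀ i ∈ Q, ∀ j ∈ Q, i ≠ j → H.Adj x i → H.Adj x j → False) :
    ColorableWith H M := by
  obtain ⟨⟨c1, c2, -, -, -, -, c7, c8, -⟩, -, hmin⟩ := hC
  let E' := C.E.comap ι hι hH
  have hsub : C.F ⊆ connectedComponentIn E'.drawingᶜ q := by
    rw [hF]
    exact connectedComponentIn_mono _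
      (compl_subset_compl.2 (C.E.comap_drawing_subset ι hι hH))
  let D : Cfg4 := ⟨m, H, E', connectedComponentIn E'.drawingᶜ q, Q, M⟩
  by_contra hcol
  have hface : ∀ i, ι i ∈ C.E.onFace C.F → i ∈ D.E.onFace D.F := fun i hi => closure_mono hsub hi
  have hD : D.Valid := by
    refine ⟨fun h => c1 (h.map ι hι hH), ⟨⟨q, fun h => hq (C.E.comap_drawing_subset ι hι hH h),
      rfl⟩, fun h => c2.2 (h.subset hsub)⟩, hQn, hQ3, fun i hi => hface i (hQF i hi), hQc, ?_, ?_,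
      fun i hi => hMin i fun h => hi (hface i h), fun i _ => hM2 i, hM1, hind, hφ, htwo⟩
    · intro i
      by_cases hi : i ∈ Q
      · exact (hM1 i hi).ge
      · exact le_trans (by norm_num) (hM2 i hi)
    · intro i j hij
      exact (Finset.card_le_card (Finset.inter_subset_inter (hM i) (hM j))).trans (c8 (hH hij))
  exact absurd (hmin D hD hcol).1 (not_le.2 hlt)

lemma MinCounterexample.exists_coloring {C : Cfg4} (hC : C.MinCounterexample)
    {S : Set (Fin C.n)} (hS : S ≠ univ) {q : ℝ × ℝ} (hq : q ∉ C.E.drawing)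
    (hF : C.F = connectedComponentIn C.E.drawingᶜ q) (Q : List (Fin C.n))
    (M : Fin C.n → Finset ℕ) (hQS : ∀ w ∈ Q, w ∈ S) (hQn : Q.Nodup) (hQ3 : Q.length ≤ 3)
    (hQF : ∀ w ∈ Q, w ∈ C.E.onFace C.F)
    (hQc : Q.IsChain fun a b => C.G.Adj a b ∧
      seg (C.E.pos a) (C.E.pos b) ⊆ closure (C.E.region S q))
    (hM : ∀ w ∈ S, w ∉ Q → M w = C.L w ∧ w ∉ C.P)
    (hM1 : ∀ w ∈ Q, M w ⊆ C.L w ∧ (M w).card = 1)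
    (hφ : ∃ φ : Fin C.n → ℕ, (∀ w ∈ Q, φ w ∈ M w) ∧
      ∀ ⦃u w⦄, u ∈ Q → w ∈ Q → C.G.Adj u w → φ u ≠ φ w)
    (htwo : ∀ y ∈ S, y ∉ Q → (C.L y).card = 2 →
      ∀ u ∈ Q, ∀ w ∈ Q, u ≠ w → C.G.Adj y u → C.G.Adj y w → False) :
    ∃ φ : Fin C.n → ℕ, (∀ w ∈ S, φ w ∈ M w) ∧
      ∀ u ∈ S, ∀ w ∈ S, C.G.Adj u w → φ u ≠ φ w := by
  classical
  have e := (Finite.equivFin S).symm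
  let ι : Fin (Nat.card S) → Fin C.n := fun i => e i
  have hι : Function.Injective ι := Subtype.val_injective.comp e.injective
  have hιS : ∀ i, ι i ∈ S := fun i => (e i).2
  have hrange : range ι = S := by
    ext w
    exact ⟨fun ⟨i, hi⟩ => hi ▸ hιS i, fun hw => ⟨e.symm ⟨w, hw⟩, congrArg Subtype.val (e.apply_symm_apply ⟨w, hw⟩)⟩⟩
  obtain ⟨Q, rfl⟩ : ∃ Q' : List (Fin (Nat.card S)), Q'.map ι = Q := by
    have : Q ∈ range (List.map ι) := by
      rw [range_list_map]
      exact fun w hw => hrange.symm ▸ hQS w hw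
    exact this
  have hlt : Nat.card S + Nat.card (C.G.comap ι).edgeSet < C.measure := by
    have h1 : Nat.card S < C.n := by
      have := Set.ncard_lt_ncard (lt_of_le_of_ne (subset_univ S) hS)
      rwa [Set.ncard_univ, Nat.card_eq_fintype_card, Fintype.card_fin] at this
    have h2 : Nat.card (C.G.comap ι).edgeSet ≤ Nat.card C.G.edgeSet :=
      Nat.card_le_card_of_injective _
        (SimpleGraph.Hom.mapEdgeSet.injective (SimpleGraph.Hom.comap ι C.G) hι)
    exact Nat.add_lt_add_of_lt_of_le h1 h2
  have hreg : connectedComponentIn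
      (C.E.comap (H := C.G.comap ι) ι hι fun _ _ h => h).drawingᶜ q = C.E.region S q := by
    rw [PlaneEmb.region]
    congr 1
    ext p
    rw [mem_compl_iff, PlaneEmb.notMem_drawing_iff]
    have hex : ∀ {w}, w ∈ S → ∃ i, ι i = w := fun hw => by
      rw [← hrange] at hw; exact hw
    constructor
    · rintro ⟨h1, h2⟩
      refine ⟨fun c hc => ?_, fun a ha b hb hab => ?_⟩
      · obtain ⟨i, rfl⟩ := hex hc
        exact h1 i (mem_univ _)
      · obtain ⟨i, rfl⟩ := hex ha
        obtain ⟨j, rfl⟩ := hex hb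
        exact h2 i (mem_univ _) j (mem_univ _) hab
    · exact fun h => ⟨fun c _ => h.1 _ (hιS c), fun a _ b _ hab => h.2 _ (hιS a) _ (hιS b) hab⟩
  obtain ⟨-, -, -, -, -, -, -, -, c9, c10, -, c12, -⟩ := id hC.1
  have hnot : ∀ {i}, i ∉ Q → ι i ∉ Q.map ι := fun {i} hi h => by
    obtain ⟨j, hj, hji⟩ := List.mem_map.1 h
    exact hi (hι hji ▸ hj)
  have hMQ : ∀ {i}, i ∉ Q → M (ι i) = C.L (ι i) := fun {i} hi => (hM _ (hιS i) (hnot hi)).1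
  have hM2 : ∀ {i}, (M (ι i)).card = 2 → i ∉ Q ∧ (C.L (ι i)).card = 2 := fun {i} h => by
    have hi : i ∉ Q := fun hi => by
      have := (hM1 (ι i) (List.mem_map_of_mem hi)).2
      omega
    exact ⟨hi, hMQ hi ▸ h⟩
  obtain ⟨φ, hφ1, hφ2⟩ := hφ
  obtain ⟨ψ, hψ1, hψ2⟩ := hC.colorable_of_lt (H := C.G.comap ι) ι hι (fun _ _ h => h) hlt hq hF Q
    (fun i => M (ι i)) (List.Nodup.of_map _ hQn) (by rwa [List.length_map] at hQ3)
    (fun i hi => hQF _ (List.mem_map_of_mem hi))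
    (by
      rw [List.isChain_map] at hQc
      rw [hreg]
      exact hQc)
    (fun i => by
      by_cases hi : i ∈ Q
      · exact (hM1 (ι i) (List.mem_map_of_mem hi)).1
      · exact (hMQ hi).le)
    (fun i hiF => by
      have hi : i ∉ Q := fun hi => hiF (hQF _ (List.mem_map_of_mem hi))
      rw [hMQ hi]
      exact c9 _ hiF)
    (fun i hi => by
      rw [hMQ hi]
      by_cases hiF : ι i ∈ C.E.onFace C.F
      · exact c10 _ hiF (hM _ (hιS i) (hnot hi)).2
      · exact le_trans (by norm_num) (c9 _ hiF))
    (fun i hi => (hM1 (ι i) (List.mem_map_of_mem hi)).2)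
    (fun i j hij hi hj => c12 hij (hM2 hi).2 (hM2 hj).2)
    ⟨fun i => φ (ι i), fun i hi => hφ1 _ (List.mem_map_of_mem hi), fun i j hi hj hij =>
      hφ2 (List.mem_map_of_mem hi) (List.mem_map_of_mem hj) hij⟩
    (fun x hx i hi j hj hij hxi hxj => htwo (ι x) (hιS x) (hnot (hM2 hx).1) (hM2 hx).2 _
      (List.mem_map_of_mem hi) _ (List.mem_map_of_mem hj) (fun h => hij (hι h)) hxi hxj)
  have hs : ∀ w (hw : w ∈ S), ι (e.symm ⟨w, hw⟩) = w := fun w hw =>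
    congrArg Subtype.val (e.apply_symm_apply ⟨w, hw⟩)
  refine ⟨fun w => if hw : w ∈ S then ψ (e.symm ⟨w, hw⟩) else 0, fun w hw => ?_,
    fun u hu w hw huw => ?_⟩
  · have := hψ1 (e.symm ⟨w, hw⟩)
    simp only [hs w hw] at this
    simpa only [dif_pos hw] using this
  · simp only [dif_pos hu, dif_pos hw]
    refine hψ2 ?_
    rw [SimpleGraph.comap_adj, hs, hs]
    exact huw

end Cfg4

lemma forall_mem_or_of_isChain {α : Type*} {R : α → α → Prop} {A : Set α} {l : List α}
    (hl : l.IsChain R) (hA : ∀ a ∈ l, ∀ b ∈ l, R a b → (a ∈ A ↔ b ∈ A)) :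
    (∀ a ∈ l, a ∈ A) ∨ ∀ a ∈ l, a ∉ A := by
  induction l with
  | nil => simp
  | cons a l ih =>
    cases l with
    | nil =>
      by_cases h : a ∈ A <;> simp [h]
    | cons b l =>
      rw [List.isChain_cons_cons] at hl
      have hab := hA a (by simp) b (by simp) hl.1
      rcases ih hl.2 (fun c hc d hd => hA c (List.mem_cons_of_mem _ hc) d
        (List.mem_cons_of_mem _ hd)) with h | h
      · exact Or.inl (List.forall_mem_cons.2 ⟨hab.2 (h b (by simp)), h⟩)
      · exact Or.inr (List.forall_mem_cons.2 ⟨fun h' => h b (by simp) (hab.1 h'), h⟩)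

namespace Cfg4

lemma subset_region (C : Cfg4) {q : ℝ × ℝ} (hF : C.F = connectedComponentIn C.E.drawingᶜ q)
    (S : Set (Fin C.n)) : C.F ⊆ C.E.region S q := by
  rw [hF]
  exact connectedComponentIn_mono _ fun p hp =>
    ((C.E.notMem_drawing_iff).1 hp).mono (subset_univ S)

lemma Valid.exists_face {C : Cfg4} (hC : C.Valid) : ∃ q, q ∉ C.E.drawing ∧
    C.F = connectedComponentIn C.E.drawingᶜ q :=
  hC.2.1.1

lemma Valid.isChain {C : Cfg4} (hC : C.Valid) : C.P.IsChain (C.E.BoundaryEdge C.F) :=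
  hC.2.2.2.2.2.1

lemma Valid.onFace_of_mem {C : Cfg4} (hC : C.Valid) {v : Fin C.n} (hv : v ∈ C.P) :
    v ∈ C.E.onFace C.F :=
  hC.2.2.2.2.1 v hv

lemma Valid.onFace_of_card {C : Cfg4} (hC : C.Valid) {v : Fin C.n} (hv : (C.L v).card = 2) :
    v ∈ C.E.onFace C.F ∧ v ∉ C.P := by
  obtain ⟨-, -, -, -, -, -, -, -, c9, -, c11, -⟩ := hC
  constructor
  · by_contra h
    have := c9 v h
    omega
  · intro h
    have := c11 v h
    omega

/-- Colorings of two subgraphs covering the graph cannot agree on their common part. -/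
lemma MinCounterexample.not_agree {C : Cfg4} (hC : C.MinCounterexample) {S T : Set (Fin C.n)}
    (hcov : ∀ w, w ∈ S ∨ w ∈ T)
    (hsep : ∀ u w, C.G.Adj u w → (u ∈ S ∧ w ∈ S) ∨ (u ∈ T ∧ w ∈ T)) {φ ψ : Fin C.n → ℕ}
    (hφ : ∀ w ∈ S, φ w ∈ C.L w) (hφ' : ∀ u ∈ S, ∀ w ∈ S, C.G.Adj u w → φ u ≠ φ w)
    (hψ : ∀ w ∈ T, ψ w ∈ C.L w) (hψ' : ∀ u ∈ T, ∀ w ∈ T, C.G.Adj u w → ψ u ≠ ψ w)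
    (hagree : ∀ w ∈ S, w ∈ T → φ w = ψ w) : False := by
  classical
  refine hC.2.1 ⟨fun w => if w ∈ S then φ w else ψ w, fun w => ?_, fun u w huw => ?_⟩
  · by_cases hw : w ∈ S
    · simpa [hw] using hφ w hw
    · simpa [hw] using hψ w ((hcov w).resolve_left hw)
  · have hT : ∀ w ∈ T, (if w ∈ S then φ w else ψ w) = ψ w := by
      intro w hw
      split_ifs with h
      exacts [hagree w h hw, rfl]
    rcases hsep u w huw with ⟨h1, h2⟩ | ⟨h1, h2⟩
    · simpa [h1, h2] using hφ' u h1 w h2 huw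
    · show (if u ∈ S then φ u else ψ u) ≠ if w ∈ S then φ w else ψ w
      rw [hT u h1, hT w h2]
      exact hψ' u h1 w h2 huw

lemma MinCounterexample.exists_coloring_of_infix {C : Cfg4} (hC : C.MinCounterexample)
    {S : Set (Fin C.n)} (hS : S ≠ univ) {Q : List (Fin C.n)} (hQ : Q <:+: C.P)
    (hQS : ∀ w ∈ Q, w ∈ S) (hPS : ∀ w ∈ C.P, w ∈ S → w ∈ Q) :
    ∃ φ : Fin C.n → ℕ, (∀ w ∈ S, φ w ∈ C.L w) ∧
      ∀ u ∈ S, ∀ w ∈ S, C.G.Adj u w → φ u ≠ φ w := by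
  obtain ⟨-, -, c3, c4, c5, c6, -, -, -, -, c11, -, ⟨φ, hφ1, hφ2⟩, c14⟩ := id hC.1
  obtain ⟨q, hq, hF⟩ := hC.1.exists_face
  have hQP : ∀ {w}, w ∈ Q → w ∈ C.P := fun h => hQ.subset h
  refine hC.exists_coloring hS hq hF Q C.L hQS (c3.sublist hQ.sublist)
    (hQ.length_le.trans c4) (fun w hw => c5 w (hQP hw)) ?_
    (fun w hw hwQ => ⟨rfl, fun hP => hwQ (hPS w hP hw)⟩)
    (fun w hw => ⟨subset_rfl, c11 w (hQP hw)⟩)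
    ⟨φ, fun w hw => hφ1 w (hQP hw), fun u w hu hw => hφ2 (hQP hu) (hQP hw)⟩
    (fun y _ _ hy u hu w hw => c14 y hy u (hQP hu) w (hQP hw))
  exact (List.IsChain.infix hC.1.isChain hQ).imp fun a b h =>
    ⟨h.1, h.2.trans (closure_mono (C.subset_region hF S))⟩

/-- Removing an edge `vw` at an `L3`-vertex `v` of the outer face. -/
lemma MinCounterexample.not_remove_edge {C : Cfg4} (hC : C.MinCounterexample) {v w : Fin C.n}
    (hvw : C.G.Adj v w) (hv3 : (C.L v).card = 3) (hvF : v ∈ C.E.onFace C.F)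
    (h2 : ∀ u, C.G.Adj v u → (C.L u).card = 2 → u = w)
    (hP : ∀ u ∈ C.P, ∀ u' ∈ C.P, u ≠ u' → C.G.Adj v u → C.G.Adj v u' → u = w ∨ u' = w) :
    False := by
  classical
  obtain ⟨-, -, c3, c4, c5, -, c7, c8, c9, c10, c11, c12, ⟨φ, hφ1, hφ2⟩, c14⟩ := id hC.1
  obtain ⟨q, hq, hF⟩ := hC.1.exists_face
  have hvP : v ∉ C.P := fun h => by
    have := c11 v h
    omega
  obtain ⟨x, hx, hxw⟩ : ∃ x ∈ C.L v, ∀ y ∈ C.L v, y ∈ C.L w → y = x := by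
    rcases (C.L v ∩ C.L w).eq_empty_or_nonempty with h | ⟨x, hx⟩
    · obtain ⟨x, hx⟩ := Finset.card_pos.1 (by omega : 0 < (C.L v).card)
      exact ⟨x, hx, fun y h1 h2 => absurd (Finset.mem_inter.2 ⟨h1, h2⟩) (by simp [h])⟩
    · exact ⟨x, (Finset.mem_inter.1 hx).1, fun y h1 h2 =>
        Finset.card_le_one.1 (c8 hvw) y (Finset.mem_inter.2 ⟨h1, h2⟩) x hx⟩
  let M : Fin C.n → Finset ℕ := Function.update C.L v ((C.L v).erase x)
  have hMv : M v = (C.L v).erase x := Function.update_self ..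
  have hMu : ∀ {u}, u ≠ v → M u = C.L u := fun h => Function.update_of_ne h ..
  have hMv2 : (M v).card = 2 := by rw [hMv, Finset.card_erase_of_mem hx, hv3]
  have hML : ∀ u, M u ⊆ C.L u := fun u => by
    by_cases h : u = v
    · rw [h, hMv]; exact Finset.erase_subset _ _
    · rw [hMu h]
  have hPv : ∀ {u}, u ∈ C.P → u ≠ v := fun hu e => hvP (e ▸ hu)
  let H := C.G.deleteEdges {s(v, w)}
  have hHle : ∀ ⦃i j⦄, H.Adj i j → C.G.Adj (id i) (id j) := fun i j h =>
    (C.G.deleteEdges_le _) h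
  have hHv : ∀ {u}, H.Adj v u → u ≠ w := by
    rintro u h rfl
    exact (SimpleGraph.deleteEdges_adj.1 h).2 rfl
  have hHo : ∀ {i j}, C.G.Adj i j → i ≠ v → j ≠ v → H.Adj i j := fun {i j} h hi hj => by
    refine SimpleGraph.deleteEdges_adj.2 ⟨h, fun e => ?_⟩
    rcases Sym2.eq_iff.1 e with ⟨e, -⟩ | ⟨-, e⟩
    exacts [hi e, hj e]
  have hlt : C.n + Nat.card H.edgeSet < C.measure := by
    refine Nat.add_lt_add_left ?_ _
    refine Set.ncard_lt_ncard ⟨?_, fun h => ?_⟩ (Set.toFinite _)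
    · exact SimpleGraph.edgeSet_mono (C.G.deleteEdges_le _)
    · have := h (show s(v, w) ∈ C.G.edgeSet from hvw)
      exact hHv ((SimpleGraph.mem_edgeSet H).1 this) rfl
  obtain ⟨ψ, hψ1, hψ2⟩ := hC.colorable_of_lt (H := H) id Function.injective_id hHle hlt hq hF
    C.P M c3 c4 c5 (by
      have hsub : C.F ⊆ connectedComponentIn
          (C.E.comap id Function.injective_id hHle).drawingᶜ q := by
        rw [hF]
        exact connectedComponentIn_mono _
          (compl_subset_compl.2 (C.E.comap_drawing_subset id Function.injective_id hHle))
      refine List.IsChain.imp_of_mem_imp (fun a b ha hb h => ?_) hC.1.isChain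
      exact ⟨hHo h.1 (hPv ha) (hPv hb), h.2.trans (closure_mono hsub)⟩)
    hML
    (fun i hi => by
      have : i ≠ v := fun e => hi (e ▸ hvF)
      rw [hMu this]
      exact c9 i hi)
    (fun i hi => by
      by_cases h : i = v
      · rw [h, hMv2]
      · rw [hMu h]
        by_cases hiF : i ∈ C.E.onFace C.F
        · exact c10 i hiF hi
        · exact le_trans (by norm_num) (c9 i hiF))
    (fun i hi => by rw [hMu (hPv hi)]; exact c11 i hi)
    (fun i j hij hi hj => by
      by_cases h : i = v
      · subst h
        rw [hMu hij.ne'] at hj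
        exact hHv hij (h2 j (hHle hij) hj)
      by_cases h' : j = v
      · subst h'
        rw [hMu h] at hi
        exact hHv hij.symm (h2 i (hHle hij.symm) hi)
      rw [hMu h] at hi
      rw [hMu h'] at hj
      exact c12 (hHle hij) hi hj)
    ⟨φ, fun u hu => by rw [hMu (hPv hu)]; exact hφ1 u hu, fun i j hi hj hij =>
      hφ2 hi hj (hHle hij)⟩
    (fun y hy i hi j hj hij hyi hyj => by
      by_cases h : y = v
      · subst h
        rcases hP i hi j hj hij (hHle hyi) (hHle hyj) with e | e
        exacts [hHv hyi e, hHv hyj e]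
      · rw [hMu h] at hy
        exact c14 y hy i hi j hj hij (hHle hyi) (hHle hyj))
  have hvw' : ψ v ≠ ψ w := by
    intro e
    have h1 := hψ1 v
    have h3 := hψ1 w
    rw [hMv, Finset.mem_erase] at h1
    rw [hMu hvw.ne', ← e] at h3
    exact h1.1 (hxw _ h1.2 h3)
  refine hC.2.1 ⟨ψ, fun u => hML u (hψ1 u), fun i j hij => ?_⟩
  by_cases h : H.Adj i j
  · exact hψ2 h
  · have : s(i, j) = s(v, w) := by
      by_contra hne
      exact h (SimpleGraph.deleteEdges_adj.2 ⟨hij, hne⟩)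
    rcases Sym2.eq_iff.1 this with ⟨rfl, rfl⟩ | ⟨rfl, rfl⟩
    exacts [hvw', hvw'.symm]

lemma MinCounterexample.not_cutvertex_of_disjoint {C : Cfg4} (hC : C.MinCounterexample)
    {v : Fin C.n} {A : Set (Fin C.n)} (hvF : v ∈ C.E.onFace C.F) (hvA : v ∉ A)
    (hA : A.Nonempty) (hcl : ∀ a ∈ A, ∀ w, C.G.Adj a w → w ≠ v → w ∈ A)
    (hout : ∃ w, w ≠ v ∧ w ∉ A) (hPA : ∀ p ∈ C.P, p ∉ A) (hvP : v ∉ C.P) : False := by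
  classical
  obtain ⟨q, hq, hF⟩ := hC.1.exists_face
  obtain ⟨a, ha⟩ := hA
  obtain ⟨b, hbv, hbA⟩ := hout
  obtain ⟨φ, hφ1, hφ2⟩ := hC.exists_coloring_of_infix (S := Aᶜ) (fun h => by
    have := h.symm ▸ mem_univ a
    exact this ha) List.infix_rfl hPA fun _ h _ => h
  let M : Fin C.n → Finset ℕ := Function.update C.L v {φ v}
  have hMv : M v = {φ v} := Function.update_self ..
  have hMu : ∀ {u}, u ≠ v → M u = C.L u := fun h => Function.update_of_ne h ..
  obtain ⟨ψ, hψ1, hψ2⟩ := hC.exists_coloring (S := insert v A) (fun h => by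
      have := h.symm ▸ mem_univ b
      exact this.elim hbv hbA) hq hF [v] M (by simp) (by simp) (by simp) (by simpa using hvF)
    (by simp)
    (fun w hw hwv => by
      rw [List.mem_singleton] at hwv
      exact ⟨hMu hwv, fun hP => hPA w hP (hw.resolve_left hwv)⟩)
    (by simpa [hMv] using hφ1 v hvA)
    ⟨φ, by simp [hMv], fun u w hu hw h => by
      rw [List.mem_singleton] at hu hw
      exact absurd (hu.trans hw.symm) h.ne⟩
    (fun y _ _ _ u hu w hw huw => by
      rw [List.mem_singleton] at hu hw
      exact absurd (hu.trans hw.symm) huw)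
  have hψv : φ v = ψ v := by
    have := hψ1 v (mem_insert _ _)
    rw [hMv, Finset.mem_singleton] at this
    exact this.symm
  refine hC.not_agree (S := Aᶜ) (T := insert v A) (φ := φ) (ψ := ψ) ?_ ?_ hφ1 hφ2 ?_ hψ2 ?_
  · intro w
    by_cases h : w ∈ A
    exacts [Or.inr (Or.inr h), Or.inl h]
  · intro u w huw
    by_cases hu : u ∈ A
    · refine Or.inr ⟨Or.inr hu, ?_⟩
      by_cases hwv : w = v
      exacts [Or.inl hwv, Or.inr (hcl u hu w huw hwv)]
    by_cases hw : w ∈ A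
    · refine Or.inr ⟨?_, Or.inr hw⟩
      by_cases huv : u = v
      exacts [Or.inl huv, Or.inr (hcl w hw u huw.symm huv)]
    exact Or.inl ⟨hu, hw⟩
  · intro w hw
    by_cases hwv : w = v
    · rw [hwv, ← hψv]
      exact hφ1 v hvA
    · exact hMu hwv ▸ hψ1 w hw
  · rintro w hw (rfl | hw')
    exacts [hψv, absurd hw' hw]

/-- A vertex of the outer face off the precolored path is not a cutvertex. -/
lemma MinCounterexample.not_cutvertex {C : Cfg4} (hC : C.MinCounterexample)
    {v : Fin C.n} {A : Set (Fin C.n)} (hvF : v ∈ C.E.onFace C.F) (hvA : v ∉ A)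
    (hA : A.Nonempty) (hcl : ∀ a ∈ A, ∀ w, C.G.Adj a w → w ≠ v → w ∈ A)
    (hout : ∃ w, w ≠ v ∧ w ∉ A) (hvP : v ∉ C.P) : False := by
  have hPv : ∀ {u}, u ∈ C.P → u ≠ v := fun hu e => hvP (e ▸ hu)
  rcases forall_mem_or_of_isChain (A := A) hC.1.isChain (fun a ha b hb h =>
    ⟨fun h' => hcl a h' b h.1 (hPv hb), fun h' => hcl b h' a h.1.symm (hPv ha)⟩) with h | h
  · obtain ⟨a, ha⟩ := hA
    obtain ⟨b, hbv, hbA⟩ := hout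
    refine hC.not_cutvertex_of_disjoint (A := {w | w ≠ v ∧ w ∉ A}) hvF (fun h => h.1 rfl)
      ⟨b, hbv, hbA⟩ ?_ ⟨a, fun e => hvA (e ▸ ha), fun h => h.2 ha⟩ (fun p hp h' => h'.2 (h p hp)) hvP
    exact fun c hc w hcw hwv => ⟨hwv, fun hw => hc.2 (hcl w hw c hcw.symm hc.1)⟩
  · exact hC.not_cutvertex_of_disjoint hvF hvA hA hcl hout h hvP

end Cfg4

/-- The vertices reachable from `a` in the graph without `v` and `x`. -/
def part (G : SimpleGraph V) (v x a : V) : Set V :=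
  {y | ∃ W : G.Walk a y, v ∉ W.support ∧ x ∉ W.support}

lemma self_mem_part {v x a : V} (hv : a ≠ v) (hx : a ≠ x) : a ∈ part G v x a :=
  ⟨.nil, by simpa using hv.symm, by simpa using hx.symm⟩

lemma mem_part_of_adj {v x a y w : V} (hy : y ∈ part G v x a) (h : G.Adj y w) (hv : w ≠ v)
    (hx : w ≠ x) : w ∈ part G v x a := by
  obtain ⟨W, h1, h2⟩ := hy
  refine ⟨W.concat h, ?_, ?_⟩ <;> simp [SimpleGraph.Walk.support_concat, *, hv.symm, hx.symm]

lemma mem_part_of_mem_support {v x a y c : V} {W : G.Walk a y} (hv : v ∉ W.support)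
    (hx : x ∉ W.support) (hc : c ∈ W.support) : c ∈ part G v x a := by
  classical
  exact ⟨W.takeUntil c hc, fun h => hv (W.support_takeUntil_subset_support hc h),
    fun h => hx (W.support_takeUntil_subset_support hc h)⟩

namespace Cfg4

/-- `K` is a union of components of the graph without the ends of the chord `vx`, and the
chord lies on the outer boundary of the subgraph spanned by `K`, `v` and `x`. -/
structure IsSide (C : Cfg4) (v x : Fin C.n) (K : Set (Fin C.n)) : Prop where
  left_notMem : v ∉ K
  right_notMem : x ∉ K
  closed : ∀ a ∈ K, ∀ w, C.G.Adj a w → w ≠ v → w ≠ x → w ∈ K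
  seg_subset : ∀ q, C.F = connectedComponentIn C.E.drawingᶜ q →
    seg (C.E.pos v) (C.E.pos x) ⊆ closure (C.E.region (insert v (insert x K)) q)

lemma MinCounterexample.exists_adj_mem_part {C : Cfg4} (hC : C.MinCounterexample)
    {v x a : Fin C.n} (hvF : v ∈ C.E.onFace C.F) (hvP : v ∉ C.P) (hvx : v ≠ x) (hav : a ≠ v)
    (hax : a ≠ x) : ∃ r ∈ part C.G v x a, C.G.Adj x r := by
  by_contra! h
  refine hC.not_cutvertex (A := part C.G v x a) hvF ?_ ⟨a, self_mem_part hav hax⟩ ?_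
    ⟨x, hvx.symm, ?_⟩ hvP
  · rintro ⟨W, h1, -⟩
    exact h1 W.end_mem_support
  · intro b hb w hbw hwv
    refine mem_part_of_adj hb hbw hwv ?_
    rintro rfl
    exact h b hb hbw.symm
  · rintro ⟨W, -, h1⟩
    exact h1 W.end_mem_support

lemma MinCounterexample.disjoint_part {C : Cfg4} (hC : C.MinCounterexample)
    {v x v0 v2 : Fin C.n} (hvP : v ∉ C.P) (h0 : C.E.BoundaryEdge C.F v v0)
    (h2 : C.E.BoundaryEdge C.F v v2) (h02 : v0 ≠ v2) (hvx : C.G.Adj v x)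
    (hxF : x ∈ C.E.onFace C.F) (hx0 : x ≠ v0) :
    Disjoint (part C.G v x v0) (part C.G v x v2) := by
  obtain ⟨q, -, hF⟩ := hC.1.exists_face
  have hvF : v ∈ C.E.onFace C.F := h0.2 (left_mem_segment ..)
  rw [Set.disjoint_left]
  rintro y ⟨W0, h1, h1'⟩ ⟨W2, h3, h3'⟩
  obtain ⟨r, ⟨W, h5, h5'⟩, hxr⟩ := hC.exists_adj_mem_part hvF hvP hvx.ne h0.1.ne' hx0.symm
  refine C.E.not_touch_three (F := C.F) (hF ▸ isPreconnected_connectedComponentIn) ?_ h0.1 h2.1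
    hvx hxr h02 W (W2.append (W0.reverse.append W)) h5 ?_ h5' ?_ h0.2 h2.2 hxF
  · intro p hp
    rw [hF] at hp
    exact (C.E.notMem_drawing_iff).1 (connectedComponentIn_subset _ _ hp)
  · simp [SimpleGraph.Walk.mem_support_append_iff, *]
  · simp [SimpleGraph.Walk.mem_support_append_iff, *]

lemma MinCounterexample.isSide_part {C : Cfg4} (hC : C.MinCounterexample)
    {v x v0 v2 : Fin C.n} (hvP : v ∉ C.P) (h0 : C.E.BoundaryEdge C.F v v0)
    (h2 : C.E.BoundaryEdge C.F v v2) (hvx : C.G.Adj v x) (hx0 : x ≠ v0) (hx2 : x ≠ v2)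
    (hd : Disjoint (part C.G v x v0) (part C.G v x v2)) : C.IsSide v x (part C.G v x v0) := by
  have hvF : v ∈ C.E.onFace C.F := h0.2 (left_mem_segment ..)
  have hvB : v ∉ part C.G v x v0 := fun ⟨W, h, _⟩ => h W.end_mem_support
  have hxB : x ∉ part C.G v x v0 := fun ⟨W, _, h⟩ => h W.end_mem_support
  refine ⟨hvB, hxB, fun a ha w => mem_part_of_adj ha, fun q hF => ?_⟩
  obtain ⟨r, ⟨W, h5, h5'⟩, hxr⟩ := hC.exists_adj_mem_part hvF hvP hvx.ne h2.1.ne' hx2.symm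
  have h22 := self_mem_part (G := C.G) h2.1.ne' hx2.symm
  refine C.E.seg_subset_closure_of_walk hvB hxB (hd.notMem_of_mem_right h22) hx2.symm hvx h0.1
    h2.1 (self_mem_part h0.1.ne' hx0.symm) ?_ (.cons hxr W.reverse) ?_ ?_
  · rintro y ⟨W, h, h'⟩ -
    refine ⟨W.reverse, fun c hc => mem_part_of_mem_support h h' (by simpa using hc)⟩
  · intro c hc
    rw [SimpleGraph.Walk.support_cons, List.mem_cons] at hc
    rcases hc with rfl | hc
    · exact ⟨hxB, hvx.ne'⟩
    · have hc : c ∈ W.support := by simpa using hc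
      refine ⟨hd.notMem_of_mem_right (mem_part_of_mem_support h5 h5' hc), ?_⟩
      rintro rfl
      exact h5 hc
  · exact closure_mono (C.subset_region hF _) (h2.2 (right_mem_segment ..))

/-- An edge from an inner vertex of a path on the outer face to a vertex of the outer face
off the path separates the two neighbours on the path. -/
lemma MinCounterexample.exists_isSide {C : Cfg4} (hC : C.MinCounterexample)
    {v x v0 v2 : Fin C.n} (hvP : v ∉ C.P) (h0 : C.E.BoundaryEdge C.F v v0)
    (h2 : C.E.BoundaryEdge C.F v v2) (h02 : v0 ≠ v2) (hvx : C.G.Adj v x)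
    (hxF : x ∈ C.E.onFace C.F) (hx0 : x ≠ v0) (hx2 : x ≠ v2) :
    ∃ K K', C.IsSide v x K ∧ C.IsSide v x K' ∧ K.Nonempty ∧ K'.Nonempty ∧ Disjoint K K' := by
  have hd := hC.disjoint_part hvP h0 h2 h02 hvx hxF hx0
  exact ⟨_, _, hC.isSide_part hvP h0 h2 hvx hx0 hx2 hd, hC.isSide_part hvP h2 h0 hvx hx2 hx0 hd.symm,
    ⟨v0, self_mem_part h0.1.ne' hx0.symm⟩, ⟨v2, self_mem_part h2.1.ne' hx2.symm⟩, hd⟩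

lemma Valid.eq_of_mem {C : Cfg4} (hC : C.Valid) {p : Fin C.n} (hp : p ∈ C.P) {a b : ℕ}
    (ha : a ∈ C.L p) (hb : b ∈ C.L p) : a = b := by
  obtain ⟨-, -, -, -, -, -, -, -, -, -, c11, -⟩ := hC
  exact Finset.card_le_one.1 (c11 p hp).le a ha b hb

/-- Splitting a minimum counterexample along the chord `vx`: the side `B` is colored last, with
`v`, `x` and the vertices of `l` precolored. -/
lemma MinCounterexample.not_isSide {C : Cfg4} (hC : C.MinCounterexample) {v x : Fin C.n}
    {B : Set (Fin C.n)} (hB : C.IsSide v x B) (hBn : B.Nonempty)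
    (hout : ∃ w, w ∉ B ∧ w ≠ v ∧ w ≠ x) (hvP : v ∉ C.P) (hvF : v ∈ C.E.onFace C.F)
    (hxF : x ∈ C.E.onFace C.F) (hvx : C.G.Adj v x) {Q l : List (Fin C.n)} (hQ : Q <:+: C.P)
    (hQB : ∀ w ∈ C.P, w ∈ Q ↔ w ∉ B) (hl : ∀ w, w ∈ l ↔ w ∈ C.P ∧ w ∈ B) (hl1 : l.length ≤ 1)
    (hchain : (x :: l).IsChain (C.E.BoundaryEdge C.F)) (hvl : ∀ b ∈ l, ¬ C.G.Adj v b)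
    (hxl : ∀ b ∈ l, x ∈ C.P)
    (htwo : ∀ y ∈ B, (C.L y).card = 2 → C.G.Adj y v → ∀ b ∈ x :: l, ¬ C.G.Adj y b) : False := by
  classical
  obtain ⟨q, hq, hF⟩ := hC.1.exists_face
  obtain ⟨-, -, -, -, c5, -, -, -, -, -, c11, -, ⟨χ, hχ1, hχ2⟩, c14⟩ := id hC.1
  obtain ⟨b, hb⟩ := hBn
  obtain ⟨o, hoB, hov, hox⟩ := hout
  have hvB := hB.left_notMem
  have hxB := hB.right_notMem
  obtain ⟨φ, hφ1, hφ2⟩ := hC.exists_coloring_of_infix (S := Bᶜ) (fun h => by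
    have := h.symm ▸ mem_univ b
    exact this hb) hQ (fun w hw => (hQB w (hQ.subset hw)).1 hw) fun w h => (hQB w h).2
  let M : Fin C.n → Finset ℕ := fun w => if w = v ∨ w = x then {φ w} else C.L w
  have hM : ∀ {w}, w = v ∨ w = x → M w = {φ w} := fun h => if_pos h
  have hM' : ∀ {w}, w ≠ v → w ≠ x → M w = C.L w := fun h h' => if_neg (by simp [h, h'])
  have hlv : ∀ {w}, w ∈ l → w ≠ v := fun hw e => hvB (e ▸ ((hl _).1 hw).2)
  have hlx : ∀ {w}, w ∈ l → w ≠ x := fun hw e => hxB (e ▸ ((hl _).1 hw).2)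
  have hφx : ∀ {w}, w ∈ l → φ x = χ x := fun hw =>
    hC.1.eq_of_mem (hxl _ hw) (hφ1 x hxB) (hχ1 x (hxl _ hw))
  have hφvx : φ v ≠ φ x := hφ2 v hvB x hxB hvx
  have hmemB : ∀ {w}, w ∈ insert v (insert x B) → w ∉ v :: x :: l → w ≠ v ∧ w ≠ x ∧ w ∈ B := by
    intro w hw hwQ
    simp only [List.mem_cons, not_or] at hwQ
    exact ⟨hwQ.1, hwQ.2.1, (hw.resolve_left hwQ.1).resolve_left hwQ.2.1⟩
  obtain ⟨ψ, hψ1, hψ2⟩ := hC.exists_coloring (S := insert v (insert x B)) (fun h => by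
      have := h.symm ▸ mem_univ o
      exact this.elim hov fun h => h.elim hox hoB) hq hF (v :: x :: l) M
    (by
      simp only [List.mem_cons]
      rintro w (rfl | rfl | hw)
      exacts [mem_insert _ _, mem_insert_of_mem _ (mem_insert _ _),
        mem_insert_of_mem _ (mem_insert_of_mem _ ((hl w).1 hw).2)])
    (by
      have : l.Nodup := by
        rcases l with _ | ⟨c, _ | ⟨d, l⟩⟩
        · simp
        · simp
        · simp at hl1
      simp only [List.nodup_cons, List.mem_cons, not_or]
      exact ⟨⟨hvx.ne, fun h => hlv h rfl⟩, fun h => hlx h rfl, this⟩)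
    (by simp only [List.length_cons]; omega)
    (by
      simp only [List.mem_cons]
      rintro w (rfl | rfl | hw)
      exacts [hvF, hxF, c5 w ((hl w).1 hw).1])
    (List.isChain_cons_cons.2 ⟨⟨hvx, hB.seg_subset q hF⟩, hchain.imp fun a b h =>
      ⟨h.1, h.2.trans (closure_mono (C.subset_region hF _))⟩⟩)
    (fun w hw hwQ => by
      obtain ⟨h1, h2, h3⟩ := hmemB hw hwQ
      refine ⟨hM' h1 h2, fun hP => hwQ ?_⟩
      simp [(hl w).2 ⟨hP, h3⟩])
    (by
      simp only [List.mem_cons]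
      rintro w (rfl | rfl | hw)
      · rw [hM (Or.inl rfl)]
        simpa using hφ1 w hvB
      · rw [hM (Or.inr rfl)]
        simpa using hφ1 w hxB
      · rw [hM' (hlv hw) (hlx hw)]
        exact ⟨subset_rfl, c11 w ((hl w).1 hw).1⟩)
    (by
      have hfl : ∀ w ∈ l, (if w = v ∨ w = x then φ w else χ w) = χ w := fun w hw =>
        if_neg (by simp [hlv hw, hlx hw])
      refine ⟨fun w => if w = v ∨ w = x then φ w else χ w, ?_, ?_⟩
      · simp only [List.mem_cons]
        rintro w (rfl | rfl | hw)
        · simp [hM]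
        · simp [hM]
        · rw [hfl w hw, hM' (hlv hw) (hlx hw)]
          exact hχ1 w ((hl w).1 hw).1
      · simp only [List.mem_cons]
        rintro u w (rfl | rfl | hu) (rfl | rfl | hw) huw
        · exact absurd rfl huw.ne
        · simpa using hφvx
        · exact absurd huw (hvl w hw)
        · simpa using hφvx.symm
        · exact absurd rfl huw.ne
        · rw [hfl w hw, if_pos (Or.inr rfl), hφx hw]
          exact hχ2 (hxl w hw) ((hl w).1 hw).1 huw
        · exact absurd huw.symm (hvl u hu)
        · rw [hfl u hu, if_pos (Or.inr rfl), hφx hu]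
          exact hχ2 ((hl u).1 hu).1 (hxl u hu) huw
        · rw [hfl u hu, hfl w hw]
          exact hχ2 ((hl u).1 hu).1 ((hl w).1 hw).1 huw)
    (fun y hyS hyQ hy2 u hu w hw huw hyu hyw => by
      obtain ⟨-, -, hyB⟩ := hmemB hyS hyQ
      rw [List.mem_cons] at hu hw
      rcases hu with rfl | hu
      · exact htwo y hyB hy2 hyu w (hw.resolve_left huw.symm) hyw
      rcases hw with rfl | hw
      · exact htwo y hyB hy2 hyw u hu hyu
      have hP : ∀ c ∈ l, ∀ d ∈ x :: l, d ∈ C.P := by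
        intro c hc d hd
        rcases List.mem_cons.1 hd with rfl | hd
        exacts [hxl c hc, ((hl d).1 hd).1]
      obtain ⟨c, hc⟩ : ∃ c, c ∈ l := by
        rcases List.mem_cons.1 hu with rfl | hu
        · exact ⟨w, (List.mem_cons.1 hw).resolve_left huw.symm⟩
        · exact ⟨u, hu⟩
      exact c14 y hy2 u (hP c hc u hu) w (hP c hc w hw) huw hyu hyw)
  have hagree : ∀ w, w = v ∨ w = x → φ w = ψ w := by
    intro w hw
    have := hψ1 w (by rcases hw with rfl | rfl <;> simp)
    rw [hM hw, Finset.mem_singleton] at this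
    exact this.symm
  have hsep : ∀ u w, u ∈ B → C.G.Adj u w → w ∈ insert v (insert x B) := by
    intro u w hu huw
    by_cases hwv : w = v
    · exact Or.inl hwv
    by_cases hwx : w = x
    · exact Or.inr (Or.inl hwx)
    exact Or.inr (Or.inr (hB.closed u hu w huw hwv hwx))
  refine hC.not_agree (S := Bᶜ) (T := insert v (insert x B)) (φ := φ) (ψ := ψ) ?_ ?_ hφ1 hφ2 ?_
    hψ2 ?_
  · intro w
    by_cases h : w ∈ B
    exacts [Or.inr (Or.inr (Or.inr h)), Or.inl h]
  · intro u w huw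
    by_cases hu : u ∈ B
    · exact Or.inr ⟨Or.inr (Or.inr hu), hsep u w hu huw⟩
    by_cases hw : w ∈ B
    · exact Or.inr ⟨hsep w u hw huw.symm, Or.inr (Or.inr hw)⟩
    exact Or.inl ⟨hu, hw⟩
  · intro w hw
    by_cases hwx : w = v ∨ w = x
    · rw [← hagree w hwx]
      rcases hwx with rfl | rfl
      exacts [hφ1 _ hvB, hφ1 _ hxB]
    · have := hψ1 w hw
      rwa [hM' (fun e => hwx (Or.inl e)) fun e => hwx (Or.inr e)] at this
  · rintro w hw (h | h | h)
    exacts [hagree w (Or.inl h), hagree w (Or.inr h), absurd h hw]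

end Cfg4

lemma PlaneEmb.BoundaryEdge.symm {E : PlaneEmb G} {F : Set (ℝ × ℝ)} {u v : V}
    (h : E.BoundaryEdge F u v) : E.BoundaryEdge F v u :=
  ⟨h.1.symm, by rw [seg, segment_symm]; exact h.2⟩

lemma eq_triple_of_isChain {α : Type*} {R : α → α → Prop} (hR : ∀ a b, R a b → R b a)
    {l : List α} (hl : l.IsChain R) (h3 : l.length ≤ 3) {x y z : α} (hx : x ∈ l)
    (hy : y ∈ l) (hz : z ∈ l) (hxy : x ≠ y) (hxz : x ≠ z) (hyz : y ≠ z) (h : ¬ R x z) :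
    l = [x, y, z] ∨ l = [z, y, x] := by
  rcases l with _ | ⟨a, _ | ⟨b, _ | ⟨c, _ | ⟨d, l⟩⟩⟩⟩
  · simp at hx
  · simp_all
  · simp at hx hy hz
    grind
  · simp at hx hy hz hl
    grind
  · simp only [List.length_cons] at h3
    omega

lemma exists_eq_triple_of_isChain {α : Type*} {R : α → α → Prop} (hR : ∀ a b, R a b → R b a)
    {l : List α} (hl : l.IsChain R) (h3 : l.length ≤ 3) {x z : α} (hx : x ∈ l)
    (hz : z ∈ l) (hxz : x ≠ z) (h : ¬ R x z) : ∃ y ∈ l, R x y ∧ R y z := by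
  rcases l with _ | ⟨a, _ | ⟨b, _ | ⟨c, _ | ⟨d, l⟩⟩⟩⟩
  · simp at hx
  · simp_all
  · simp at hx hz hl
    grind
  · simp at hx hz hl
    grind
  · simp only [List.length_cons] at h3
    omega

namespace Cfg4

lemma Valid.isChain_adj {C : Cfg4} (hC : C.Valid) : C.P.IsChain C.G.Adj :=
  hC.isChain.imp fun _ _ h => h.1

lemma Valid.notMem_of_card {C : Cfg4} (hC : C.Valid) {v : Fin C.n} (hv : (C.L v).card = 3) :
    v ∉ C.P := by
  obtain ⟨-, -, -, -, -, -, -, -, -, -, c11, -⟩ := hC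
  intro h
  have := c11 v h
  omega

lemma MinCounterexample.not_isSide_of_card_two {C : Cfg4} (hC : C.MinCounterexample)
    {v u : Fin C.n} {B K : Set (Fin C.n)} (hB : C.IsSide v u B) (hK : C.IsSide v u K)
    (hBn : B.Nonempty) (hKn : K.Nonempty) (hd : Disjoint B K) (hvP : v ∉ C.P)
    (hvF : v ∈ C.E.onFace C.F) (hvu : C.G.Adj v u) (hu : (C.L u).card = 2)
    (hPB : ∀ p ∈ C.P, p ∉ B) : False := by
  obtain ⟨o, ho⟩ := hKn
  obtain ⟨huF, -⟩ := hC.1.onFace_of_card hu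
  obtain ⟨-, -, -, -, -, -, -, -, -, -, -, c12, -⟩ := id hC.1
  refine hC.not_isSide hB hBn ⟨o, hd.notMem_of_mem_right ho, fun e => hK.left_notMem (e ▸ ho),
    fun e => hK.right_notMem (e ▸ ho)⟩ hvP hvF huF hvu (Q := C.P) (l := []) List.infix_rfl
    (fun w hw => iff_of_true hw (hPB w hw)) (fun w => ?_) (by simp) (by simp) (by simp) (by simp) ?_
  · simpa using hPB w
  · intro y _ hy2 _ b hb hyb
    rw [List.mem_singleton] at hb
    exact c12 hyb hy2 (hb ▸ hu)

/-- An `L2`-neighbour of an inner vertex `v` of a path `v0 v v2` on the outer face lies on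
that path. -/
lemma MinCounterexample.eq_or_eq_of_card_two {C : Cfg4} (hC : C.MinCounterexample)
    {v u v0 v2 : Fin C.n} (hvP : v ∉ C.P) (h0 : C.E.BoundaryEdge C.F v v0)
    (h2 : C.E.BoundaryEdge C.F v v2) (h02 : v0 ≠ v2) (hvu : C.G.Adj v u)
    (hu : (C.L u).card = 2) : u = v0 ∨ u = v2 := by
  by_contra! h
  have hvF : v ∈ C.E.onFace C.F := h0.2 (left_mem_segment ..)
  obtain ⟨huF, huP⟩ := hC.1.onFace_of_card hu
  obtain ⟨K, K', hK, hK', hn, hn', hd⟩ := hC.exists_isSide hvP h0 h2 h02 hvu huF h.1 h.2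
  rcases forall_mem_or_of_isChain (A := K) hC.1.isChain_adj (fun a ha b hb hab =>
    ⟨fun h' => hK.closed a h' b hab (fun e => hvP (e ▸ hb)) (fun e => huP (e ▸ hb)),
      fun h' => hK.closed b h' a hab.symm (fun e => hvP (e ▸ ha)) (fun e => huP (e ▸ ha))⟩)
    with hP | hP
  · exact hC.not_isSide_of_card_two hK' hK hn' hn hd.symm hvP hvF hvu hu
      fun p hp => hd.notMem_of_mem_left (hP p hp)
  · exact hC.not_isSide_of_card_two hK hK' hn hn' hd hvP hvF hvu hu hP

lemma Valid.adj_of_adj_adj {C : Cfg4} (hC : C.Valid) {v x z : Fin C.n} (hvP : v ∉ C.P)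
    (hx : x ∈ C.P) (hz : z ∈ C.P) (hxz : x ≠ z) (hvx : C.G.Adj v x) (hvz : C.G.Adj v z) :
    C.G.Adj x z := by
  by_contra h
  obtain ⟨y, hy, hxy, hyz⟩ := exists_eq_triple_of_isChain (fun _ _ h => h.symm) hC.isChain_adj
    hC.2.2.2.1 hx hz hxz h
  exact hC.1 (hasCycleLen_four hvx hxy hyz hvz.symm (fun e => hvP (e ▸ hy)) hxz)

lemma MinCounterexample.not_isSide_of_mem {C : Cfg4} (hC : C.MinCounterexample)
    {v x z : Fin C.n} {B : Set (Fin C.n)} (hB : C.IsSide v x B) (hBn : B.Nonempty)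
    (hzB : z ∉ B) (hvP : v ∉ C.P) (hvF : v ∈ C.E.onFace C.F) (hx : x ∈ C.P) (hz : z ∈ C.P)
    (hxz : x ≠ z) (hvx : C.G.Adj v x) (hvz : C.G.Adj v z) : False := by
  have hzv := hvz.ne'
  have hadj := hC.1.adj_of_adj_adj hvP hx hz hxz hvx hvz
  have hxB := hB.right_notMem
  have h4 := hC.1.1
  have htri : ∀ y ∈ B, C.G.Adj y v → ¬ C.G.Adj y x := fun y hy hyv hyx =>
    h4 (hasCycleLen_four hyv hvz hadj.symm hyx.symm (fun e => hzB (e ▸ hy)) hvx.ne)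
  have key := fun Q l => hC.not_isSide (Q := Q) (l := l) hB hBn ⟨z, hzB, hzv, hxz.symm⟩ hvP hvF
    (hC.1.onFace_of_mem hx) hvx
  by_cases h : ∃ b ∈ C.P, b ∈ B
  · obtain ⟨b, hbP, hbB⟩ := h
    have hbx : b ≠ x := fun e => hxB (e ▸ hbB)
    have hbz : b ≠ z := fun e => hzB (e ▸ hbB)
    have hbv : b ≠ v := fun e => hvP (e ▸ hbP)
    have hzb : ¬ C.G.Adj z b := fun h => hzB (hB.closed b hbB z h.symm hzv hxz.symm)
    have hP := eq_triple_of_isChain (fun _ _ h => h.symm) hC.1.isChain_adj hC.1.2.2.2.1 hz hx hbP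
      hxz.symm hbz.symm hbx.symm hzb
    have hxb : C.E.BoundaryEdge C.F x b := by
      have := hC.1.isChain
      rcases hP with e | e <;> simp only [e, List.isChain_cons_cons] at this
      exacts [this.2.1, this.1.symm]
    have hmem : ∀ w, w ∈ C.P ↔ w = z ∨ w = x ∨ w = b := by
      rcases hP with e | e <;> simp [e]; tauto
    have hw : ∀ w, w ∈ [b] ↔ w ∈ C.P ∧ w ∈ B := by
      intro w
      rw [hmem, List.mem_singleton]
      constructor
      · rintro rfl
        exact ⟨Or.inr (Or.inr rfl), hbB⟩
      · rintro ⟨rfl | rfl | rfl, h⟩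
        exacts [absurd h hzB, absurd h hxB, rfl]
    have hfin := fun Q h1 h2 => key Q [b] h1 h2 hw (by simp) (by simpa using hxb)
      (by
        simp only [List.mem_singleton, forall_eq]
        exact fun hvb => h4 (hasCycleLen_four hvb hxb.1.symm hadj hvz.symm hvx.ne hbz))
      (fun _ _ => hx)
      (by
        intro y hy _ hyv c hc hyc
        simp only [List.mem_cons, List.not_mem_nil, or_false] at hc
        rcases hc with rfl | rfl
        · exact htri y hy hyv hyc
        · exact h4 (hasCycleLen_four hyv hvx hxb.1 hyc.symm (fun e => hxB (e ▸ hy)) hbv.symm))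
    rcases hP with e | e
    · refine hfin [z, x] ⟨[], [b], by simp [e]⟩ fun w hw => ?_
      rw [hmem] at hw
      rcases hw with rfl | rfl | rfl <;> simp [*]
    · refine hfin [x, z] ⟨[b], [], by simp [e]⟩ fun w hw => ?_
      rw [hmem] at hw
      rcases hw with rfl | rfl | rfl <;> simp [*]
  · push Not at h
    refine key C.P [] List.infix_rfl (fun w hw => iff_of_true hw (h w hw)) (fun w => ?_) (by simp)
      (by simp) (by simp) (by simp) ?_
    · simpa using h w
    · intro y hy _ hyv b hb
      rw [List.mem_singleton] at hb
      exact hb ▸ htri y hy hyv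

lemma MinCounterexample.not_adj_of_mem {C : Cfg4} (hC : C.MinCounterexample)
    {v x z v0 v2 : Fin C.n} (hvP : v ∉ C.P) (h0 : C.E.BoundaryEdge C.F v v0)
    (h2 : C.E.BoundaryEdge C.F v v2) (h02 : v0 ≠ v2) (hx : x ∈ C.P) (hz : z ∈ C.P)
    (hxz : x ≠ z) (hvx : C.G.Adj v x) (hvz : C.G.Adj v z) (hx0 : x ≠ v0) (hx2 : x ≠ v2) :
    False := by
  have hvF : v ∈ C.E.onFace C.F := h0.2 (left_mem_segment ..)
  obtain ⟨K, K', hK, hK', hn, hn', hd⟩ := hC.exists_isSide hvP h0 h2 h02 hvx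
    (hC.1.onFace_of_mem hx) hx0 hx2
  by_cases h : z ∈ K
  · exact hC.not_isSide_of_mem hK' hn' (hd.notMem_of_mem_left h) hvP hvF hx hz hxz hvx hvz
  · exact hC.not_isSide_of_mem hK hn h hvP hvF hx hz hxz hvx hvz

lemma MinCounterexample.card_eq_two {C : Cfg4} (hC : C.MinCounterexample)
    {v v0 v2 : Fin C.n} (hv3 : (C.L v).card = 3) (h0 : C.E.BoundaryEdge C.F v v0)
    (h2 : C.E.BoundaryEdge C.F v v2) (h02 : v0 ≠ v2) : (C.L v0).card = 2 := by
  have hvP := hC.1.notMem_of_card hv3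
  by_contra h
  refine hC.not_remove_edge h2.1 hv3 (h0.2 (left_mem_segment ..)) (fun u hvu hu => ?_)
    fun u hu u' hu' huu' hvu hvu' => ?_
  · rcases hC.eq_or_eq_of_card_two hvP h0 h2 h02 hvu hu with rfl | e
    exacts [absurd hu h, e]
  · by_contra! hne
    by_cases hu0 : u = v0
    · exact hC.not_adj_of_mem hvP h0 h2 h02 hu' hu huu'.symm hvu' hvu
        (fun e => huu' (hu0.trans e.symm)) hne.2
    · exact hC.not_adj_of_mem hvP h0 h2 h02 hu hu' huu' hvu hvu' hu0 hne.1

end Cfg4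

/-- **Claim 10 in the proof of Theorem 6.** In a minimum counterexample to Theorem 6, if
`v0 v1 v2` is a path on the outer cycle with `|L(v1)| = 3`, then `v0` and `v2` are
`L2`-vertices and they are the only `L2`-vertices adjacent to `v1`. -/
theorem min_cex_C4free_L3_vertex_neighbors (C : Cfg4) (hC : C.MinCounterexample) :
    ∀ v0 v1 v2 : Fin C.n, C.IsOuterPath v0 v1 v2 → (C.L v1).card = 3 →
      (C.L v0).card = 2 ∧ (C.L v2).card = 2 ∧
        ∀ u : Fin C.n, C.G.Adj v1 u → (C.L u).card = 2 → u = v0 ∨ u = v2 := by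
  intro v0 v1 v2 ⟨h02, h0, h2⟩ hv3
  exact ⟨hC.card_eq_two hv3 h0.symm h2 h02, hC.card_eq_two hv3 h2 h0.symm h02.symm, fun _ =>
    hC.eq_or_eq_of_card_two (hC.1.notMem_of_card hv3) h0.symm h2 h02⟩

end ChoosSep
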